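/- Let s ∈ ℂ with Re(s) > −1. For every integer N ≥ 0, one has ∑_{p ≤ x} p^s − ∑_{k=0}^{N−1} k!·x^{s+1}/((s+1)·log x)^{k+1} ∼ N!·x^{s+1}/((s+1)·log x)^{N+1} as x → ∞ (x real), i.e. the ratio of the two sides tends to 1 in ℂ; that is, π_s(x) has the asymptotic expansion π_s(x) ∼ ∑_{k=0}^∞ k!·x^{s+1}/((s+1)·log x)^{k+1} as x → ∞. -/

import Mathlib

open Filter

/-- `π_s(x) = ∑_{p ≤ x} p^s`, the sum over primes `p ≤ x`. -/
noncomputable def piPow (s : ℂ) (x : ℝ) : ℂ :=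
  ∑ p ∈ (⌊x⌋₊ + 1).primesBelow, (p : ℂ) ^ s

section
open Complex Set Topology

/-- The `n`-th term of the series `∑ (n^{-s} - ∫_n^{n+1} u^{-s} du)` continuing
`ζ(s) - 1/(s-1)` to the left of `Re s = 1`, indexed from `n + 1`. -/
noncomputable def zetaDiffTerm (n : ℕ) (s : ℂ) : ℂ :=
  1 / ((n : ℂ) + 1) ^ s
    - (((n + 1 : ℕ) + 1 : ℂ) ^ (1 - s) - ((n : ℂ) + 1) ^ (1 - s)) / (1 - s)

lemma zetaDiffTerm_eq_integral (n : ℕ) {s : ℂ} (hs : s ≠ 1) :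
    zetaDiffTerm n s =
      ∫ u in ((n : ℝ) + 1)..((n : ℝ) + 2), ((((n : ℝ) + 1 : ℝ) : ℂ) ^ (-s) - (u : ℂ) ^ (-s)) := by
  have h0 : (0 : ℝ) ∉ uIcc ((n : ℝ) + 1) ((n : ℝ) + 2) := by
    rw [uIcc_of_le (by linarith)]
    intro h
    have := h.1
    have : (0 : ℝ) ≤ n := n.cast_nonneg
    linarith
  have hs' : -s ≠ -1 := fun h => hs (neg_injective h)
  rw [intervalIntegral.integral_sub (by simp)
    (intervalIntegral.intervalIntegrable_cpow (Or.inr h0)),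
    integral_cpow (Or.inr ⟨hs', h0⟩), intervalIntegral.integral_const, zetaDiffTerm, cpow_neg]
  have e : -s + 1 = 1 - s := by ring
  rw [e]
  push_cast
  simp only [one_div, real_smul]
  push_cast
  ring_nf

lemma norm_zetaDiffTerm_le {a : ℝ} (ha0 : 0 ≤ a) (ha1 : a ≤ 1) (n : ℕ) {s : ℂ} (hs : s ≠ 1)
    (hs0 : 0 < s.re) :
    ‖zetaDiffTerm n s‖ ≤ 2 * ‖s‖ ^ a * ((n : ℝ) + 1) ^ (-(s.re + a)) := by
  have hn : (0 : ℝ) < (n : ℝ) + 1 := by positivity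
  set N : ℝ := (n : ℝ) + 1 with hN
  have key : ∀ u ∈ uIoc N ((n : ℝ) + 2),
      ‖((N : ℝ) : ℂ) ^ (-s) - (u : ℂ) ^ (-s)‖ ≤ 2 * ‖s‖ ^ a * N ^ (-(s.re + a)) := by
    intro u hu
    rw [uIoc_of_le (by linarith)] at hu
    have hu0 : 0 < u := hn.trans hu.1
    have b1 : ‖((N : ℝ) : ℂ) ^ (-s) - (u : ℂ) ^ (-s)‖ ≤ 2 * N ^ (-s.re) := by
      refine (norm_sub_le _ _).trans ?_
      rw [norm_cpow_eq_rpow_re_of_pos hn, norm_cpow_eq_rpow_re_of_pos hu0, neg_re]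
      have := Real.rpow_le_rpow_of_nonpos hn hu.1.le (neg_nonpos.2 hs0.le)
      linarith
    have b2 : ‖((N : ℝ) : ℂ) ^ (-s) - (u : ℂ) ^ (-s)‖ ≤ ‖s‖ / N * N ^ (-s.re) := by
      have hd : ∀ x ∈ Icc N u, HasDerivWithinAt (fun y : ℝ => (y : ℂ) ^ (-s))
          (-s * (x : ℂ) ^ (-s - 1)) (Icc N u) x := fun x hx =>
        (hasDerivAt_ofReal_cpow_const (hn.trans_le hx.1).ne'
          (by intro h; rw [neg_eq_zero] at h; simp [h] at hs0)).hasDerivWithinAt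
      have := Convex.norm_image_sub_le_of_norm_hasDerivWithin_le (𝕜 := ℝ) (C := ‖s‖ / N * N ^ (-s.re))
        hd ?_ (convex_Icc _ _) (left_mem_Icc.2 hu.1.le) (right_mem_Icc.2 hu.1.le)
      · rw [norm_sub_rev]
        refine this.trans ?_
        have h1 : ‖u - N‖ ≤ 1 := by
          rw [Real.norm_of_nonneg (by linarith [hu.1])]; linarith [hu.2]
        have h2 : 0 ≤ ‖s‖ / N * N ^ (-s.re) := by positivity
        nlinarith
      · intro x hx
        have hx0 : 0 < x := hn.trans_le hx.1
        rw [norm_mul, norm_neg, norm_cpow_eq_rpow_re_of_pos hx0]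
        have e : (-s - 1).re = -s.re - 1 := by simp
        have h3 : ‖s‖ / N * N ^ (-s.re) = ‖s‖ * N ^ (-s.re - 1) := by
          rw [Real.rpow_sub_one hn.ne']; ring
        rw [e, h3]
        exact mul_le_mul_of_nonneg_left
          (Real.rpow_le_rpow_of_nonpos hn hx.1 (by linarith)) (norm_nonneg _)
    have e : 2 * ‖s‖ ^ a * N ^ (-(s.re + a)) = 2 * (‖s‖ / N) ^ a * N ^ (-s.re) := by
      rw [Real.div_rpow (norm_nonneg _) hn.le, neg_add, Real.rpow_add hn, Real.rpow_neg hn.le a]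
      ring
    rw [e]
    have hp : 0 ≤ N ^ (-s.re) := by positivity
    rcases le_total 1 (‖s‖ / N) with h | h
    · refine b1.trans (mul_le_mul_of_nonneg_right ?_ hp)
      linarith [Real.one_le_rpow h ha0]
    · refine b2.trans (mul_le_mul_of_nonneg_right ?_ hp)
      have h0 : 0 ≤ ‖s‖ / N := by positivity
      have h1 : ‖s‖ / N ≤ (‖s‖ / N) ^ a := by
        rcases h0.eq_or_lt with h' | h'
        · rw [← h']; positivity
        · simpa using Real.rpow_le_rpow_of_exponent_ge h' h ha1
      have : 0 ≤ (‖s‖ / N) ^ a := by positivity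
      linarith
  rw [zetaDiffTerm_eq_integral n hs]
  refine (intervalIntegral.norm_integral_le_of_norm_le_const key).trans (le_of_eq ?_)
  rw [hN]
  have : |(n : ℝ) + 2 - ((n : ℝ) + 1)| = 1 := by norm_num
  rw [this, mul_one]

lemma summable_nat_add_one_rpow {p : ℝ} (hp : p < -1) :
    Summable fun n : ℕ => ((n : ℝ) + 1) ^ p := by
  have := (summable_nat_add_iff 1).2 (Real.summable_nat_rpow.2 hp)
  simpa using this

lemma tsum_zetaDiffTerm_of_one_lt_re {s : ℂ} (hs : 1 < s.re) :
    ∑' n, zetaDiffTerm n s = riemannZeta s - 1 / (s - 1) := by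
  have hs1 : s ≠ 1 := by rintro rfl; simp at hs
  have hsum : Summable fun n => zetaDiffTerm n s := by
    refine Summable.of_norm_bounded (g := fun n : ℕ => 2 * ‖s‖ ^ (0 : ℝ) * ((n : ℝ) + 1) ^ (-(s.re + 0)))
      ((summable_nat_add_one_rpow (by linarith)).mul_left _)
      fun n => norm_zetaDiffTerm_le le_rfl zero_le_one n hs1 (by linarith)
  have hz : Summable fun n : ℕ => 1 / ((n : ℂ) + 1) ^ s := by
    have := (summable_nat_add_iff 1).2 (Complex.summable_one_div_nat_cpow.2 hs)
    simpa using this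
  have h1 := hsum.hasSum.tendsto_sum_nat
  have h2 := hz.hasSum.tendsto_sum_nat
  rw [← zeta_eq_tsum_one_div_nat_add_one_cpow hs] at h2
  have h3 : Tendsto (fun m : ℕ => ((m : ℂ) + 1) ^ (1 - s)) atTop (𝓝 0) := by
    rw [tendsto_zero_iff_norm_tendsto_zero]
    have h4 : Tendsto (fun m : ℕ => ((m : ℝ) + 1) ^ (-(s.re - 1))) atTop (𝓝 0) :=
      (tendsto_rpow_neg_atTop (by linarith)).comp
        (tendsto_atTop_add_const_right _ _ tendsto_natCast_atTop_atTop)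
    refine h4.congr fun m => ?_
    have := norm_cpow_eq_rpow_re_of_pos (x := (m : ℝ) + 1) (by positivity) (1 - s)
    push_cast at this
    rw [this]; simp
  have h5 : ∀ M : ℕ, ∑ n ∈ Finset.range M, zetaDiffTerm n s
      = ∑ n ∈ Finset.range M, 1 / ((n : ℂ) + 1) ^ s - (((M : ℂ) + 1) ^ (1 - s) - 1) / (1 - s) := by
    intro M
    have := Finset.sum_range_sub (fun m : ℕ => ((m : ℂ) + 1) ^ (1 - s)) M
    simp only [zetaDiffTerm, Finset.sum_sub_distrib, ← Finset.sum_div]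
    rw [← Finset.sum_sub_distrib, this]
    simp
  have h6 := (h2.sub ((h3.sub_const 1).div_const (1 - s))).congr fun M => (h5 M).symm
  rw [tendsto_nhds_unique h1 h6, zero_sub, neg_div, ← div_neg, neg_sub]

lemma differentiable_zetaDiffTerm (n : ℕ) {s : ℂ} (hs : s ≠ 1) :
    DifferentiableAt ℂ (zetaDiffTerm n) s := by
  have h1 : ((n : ℂ) + 1) ≠ 0 := n.cast_add_one_ne_zero
  have h2 : (((n + 1 : ℕ) : ℂ) + 1) ≠ 0 := (n + 1).cast_add_one_ne_zero
  have h3 : 1 - s ≠ 0 := sub_ne_zero.2 hs.symm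
  have h4 : ((n : ℂ) + 1) ^ s ≠ 0 := by simp [cpow_eq_zero_iff, h1]
  unfold zetaDiffTerm
  refine DifferentiableAt.sub ?_ (DifferentiableAt.div ?_ (by fun_prop) h3)
  · exact (differentiableAt_const _).div (differentiableAt_id.const_cpow (Or.inl h1)) h4
  · exact ((differentiableAt_id.const_sub 1).const_cpow (Or.inl h2)).sub
      ((differentiableAt_id.const_sub 1).const_cpow (Or.inl h1))

lemma riemannZeta_eq_tsum_zetaDiffTerm {s : ℂ} (hs : 0 < s.re) (ht : 0 < s.im) :
    riemannZeta s - 1 / (s - 1) = ∑' n, zetaDiffTerm n s := by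
  set R : ℝ := ‖s‖ + 4 with hR
  set V : Set ℂ := ({z | s.re / 2 < z.re} ∩ {z | 0 < z.im}) ∩ Metric.ball 0 R with hV
  have hVo : IsOpen V :=
    ((isOpen_lt continuous_const continuous_re).inter
      (isOpen_lt continuous_const continuous_im)).inter Metric.isOpen_ball
  have hVc : IsPreconnected V :=
    (((convex_halfSpace_re_gt _).inter (convex_halfSpace_im_gt _)).inter
      (convex_ball _ _)).isPreconnected
  have hne : ∀ z ∈ V, z ≠ 1 := by
    rintro z ⟨⟨_, h⟩, _⟩ rfl
    simp at h
  have hf : DifferentiableOn ℂ (fun z => riemannZeta z - 1 / (z - 1)) V := by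
    intro z hz
    have h1 := differentiableAt_riemannZeta (hne z hz)
    have h2 : z - 1 ≠ 0 := sub_ne_zero.2 (hne z hz)
    have h3 : DifferentiableAt ℂ (fun z : ℂ => 1 / (z - 1)) z := by fun_prop (disch := assumption)
    exact (h1.sub h3).differentiableWithinAt
  have hg : DifferentiableOn ℂ (fun z => ∑' n, zetaDiffTerm n z) V := by
    refine differentiableOn_tsum_of_summable_norm
      (u := fun n : ℕ => 2 * R * ((n : ℝ) + 1) ^ (-(s.re / 2 + 1)))
      ((summable_nat_add_one_rpow (by linarith)).mul_left _)
      (fun n z hz => (differentiable_zetaDiffTerm n (hne z hz)).differentiableWithinAt) hVo ?_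
    rintro n z hz
    have h1 : s.re / 2 < z.re := hz.1.1
    have h2 : ‖z‖ < R := by simpa using hz.2
    refine (norm_zetaDiffTerm_le zero_le_one le_rfl n (hne z hz) (by linarith)).trans ?_
    rw [Real.rpow_one]
    have h3 : ((n : ℝ) + 1) ^ (-(z.re + 1)) ≤ ((n : ℝ) + 1) ^ (-(s.re / 2 + 1)) :=
      Real.rpow_le_rpow_of_exponent_le (by linarith [(n.cast_nonneg : (0 : ℝ) ≤ n)]) (by linarith)
    exact mul_le_mul (by linarith) h3 (by positivity) (by positivity)
  have hsV : s ∈ V := ⟨⟨show s.re / 2 < s.re by linarith, ht⟩, by simp [hR]⟩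
  set z₀ : ℂ := s + 2 with hz₀
  have hz₀V : z₀ ∈ V := by
    refine ⟨⟨by simp [hz₀]; linarith, by simpa [hz₀] using ht⟩, ?_⟩
    have : ‖s + 2‖ ≤ ‖s‖ + 2 := by simpa using norm_add_le s 2
    simp [hR, hz₀]; linarith
  refine AnalyticOnNhd.eqOn_of_preconnected_of_eventuallyEq (hf.analyticOnNhd hVo)
    (hg.analyticOnNhd hVo) hVc hz₀V ?_ hsV
  have : ∀ᶠ z in 𝓝 z₀, 1 < z.re :=
    (isOpen_lt continuous_const continuous_re).mem_nhds (by simp [hz₀]; linarith)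
  filter_upwards [this] with z hz using (tsum_zetaDiffTerm_of_one_lt_re hz).symm

/-- A convexity-free bound for `ζ` slightly to the left of the line `Re s = 1`. -/
lemma exists_norm_riemannZeta_le {a : ℝ} (ha0 : 0 < a) (ha1 : a ≤ 1) :
    ∃ C : ℝ, 0 < C ∧ ∀ s : ℂ, 1 - a / 2 ≤ s.re → s.re ≤ 3 → 1 / 2 ≤ |s.im| →
      ‖riemannZeta s‖ ≤ C * |s.im| ^ a := by
  have hS := summable_nat_add_one_rpow (p := -(1 + a / 2)) (by linarith)
  set S : ℝ := ∑' n : ℕ, ((n : ℝ) + 1) ^ (-(1 + a / 2)) with hSdef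
  have hS0 : 0 ≤ S := tsum_nonneg fun n => by positivity
  refine ⟨2 * 7 ^ a * S + 4, by positivity, ?_⟩
  have main : ∀ s : ℂ, 1 - a / 2 ≤ s.re → s.re ≤ 3 → 1 / 2 ≤ s.im →
      ‖riemannZeta s‖ ≤ (2 * 7 ^ a * S + 4) * s.im ^ a := by
    intro s h1 h2 h3
    have hs1 : s ≠ 1 := by rintro rfl; norm_num at h3
    have hre : 0 < s.re := by linarith
    have hnorm : ‖s‖ ≤ 7 * s.im := by
      have := norm_le_abs_re_add_abs_im s
      rw [abs_of_pos hre, abs_of_pos (show 0 < s.im by linarith)] at this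
      linarith
    have hb : ∀ n : ℕ, ‖zetaDiffTerm n s‖ ≤ 2 * ‖s‖ ^ a * ((n : ℝ) + 1) ^ (-(1 + a / 2)) := by
      intro n
      refine (norm_zetaDiffTerm_le ha0.le ha1 n hs1 hre).trans ?_
      refine mul_le_mul_of_nonneg_left (Real.rpow_le_rpow_of_exponent_le ?_ ?_) (by positivity)
      · linarith [(n.cast_nonneg : (0 : ℝ) ≤ n)]
      · linarith
    have ht : ‖∑' n, zetaDiffTerm n s‖ ≤ 2 * ‖s‖ ^ a * S := by
      rw [hSdef, ← tsum_mul_left]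
      exact tsum_of_norm_bounded (hS.mul_left _).hasSum hb
    have e : riemannZeta s = ∑' n, zetaDiffTerm n s + 1 / (s - 1) := by
      rw [← riemannZeta_eq_tsum_zetaDiffTerm hre (by linarith)]; ring
    have h4 : ‖1 / (s - 1)‖ ≤ 2 := by
      have : 1 / 2 ≤ ‖s - 1‖ := by
        have := abs_im_le_norm (s - 1)
        simp at this
        linarith [le_abs_self s.im]
      rw [norm_div, norm_one, div_le_iff₀ (by linarith)]
      linarith
    have h5 : ‖s‖ ^ a ≤ 7 ^ a * s.im ^ a := by
      rw [← Real.mul_rpow (by norm_num) (by linarith)]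
      gcongr
    have h6 : (1 / 2 : ℝ) ≤ s.im ^ a :=
      calc (1 / 2 : ℝ) = (1 / 2) ^ (1 : ℝ) := by simp
        _ ≤ (1 / 2) ^ a := Real.rpow_le_rpow_of_exponent_ge (by norm_num) (by norm_num) ha1
        _ ≤ s.im ^ a := by gcongr
    rw [e]
    refine (norm_add_le _ _).trans ?_
    have := mul_le_mul_of_nonneg_right h5 hS0
    nlinarith
  intro s h1 h2 h3
  rcases le_or_gt 0 s.im with h | h
  · rw [abs_of_nonneg h] at h3 ⊢
    exact main s h1 h2 h3
  · rw [abs_of_neg h] at h3 ⊢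
    have := main ((starRingEnd ℂ) s) (by simpa using h1) (by simpa using h2) (by simpa using h3)
    rwa [riemannZeta_conj, RCLike.norm_conj, conj_im] at this
end

section
open Complex Set Topology

/-- The derivative `ζ'` inherits the bound on `ζ` from Cauchy's estimate. -/
lemma exists_norm_deriv_riemannZeta_le {a : ℝ} (ha0 : 0 < a) (ha1 : a ≤ 1) :
    ∃ C : ℝ, 0 < C ∧ ∀ s : ℂ, 1 - a / 4 ≤ s.re → s.re ≤ 5 / 2 → 3 / 4 ≤ |s.im| →
      ‖deriv riemannZeta s‖ ≤ C * |s.im| ^ a := by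
  obtain ⟨C, hC, hb⟩ := exists_norm_riemannZeta_le ha0 ha1
  refine ⟨C * 2 ^ a / (a / 4), by positivity, fun s h1 h2 h3 => ?_⟩
  have hball : ∀ w ∈ Metric.closedBall s (a / 4),
      1 - a / 2 ≤ w.re ∧ w.re ≤ 3 ∧ 1 / 2 ≤ |w.im| ∧ |w.im| ≤ 2 * |s.im| := by
    intro w hw
    rw [mem_closedBall_iff_norm] at hw
    have hre := abs_le.1 ((abs_re_le_norm (w - s)).trans hw)
    have him := (abs_im_le_norm (w - s)).trans hw
    simp only [sub_re, sub_im] at hre him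
    have t1 := abs_sub_abs_le_abs_sub w.im s.im
    have t2 := abs_sub_abs_le_abs_sub s.im w.im
    rw [abs_sub_comm] at t2
    exact ⟨by linarith, by linarith, by linarith, by linarith⟩
  have hd : DiffContOnCl ℂ riemannZeta (Metric.ball s (a / 4)) := by
    refine DifferentiableOn.diffContOnCl_ball (U := Metric.closedBall s (a / 4)) ?_ subset_rfl
    intro w hw
    refine (differentiableAt_riemannZeta ?_).differentiableWithinAt
    rintro rfl
    have := (hball 1 hw).2.2.1
    norm_num at this
  have := norm_deriv_le_of_forall_mem_sphere_norm_le (C := C * 2 ^ a * |s.im| ^ a)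
    (by positivity) hd fun w hw => ?_
  · refine this.trans (le_of_eq ?_)
    ring
  · obtain ⟨g1, g2, g3, g4⟩ := hball w (Metric.sphere_subset_closedBall hw)
    refine (hb w g1 g2 g3).trans ?_
    rw [mul_assoc, ← Real.mul_rpow (by norm_num) (abs_nonneg _)]
    gcongr

lemma exists_norm_riemannZeta_one_add_le :
    ∃ C : ℝ, 0 < C ∧ ∀ x : ℝ, 0 < x → x ≤ 1 → ‖riemannZeta (1 + x)‖ ≤ C / x := by
  obtain ⟨C, hC⟩ := (isCompact_Icc (a := (0 : ℝ)) (b := 1)).exists_bound_of_continuousOn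
    (f := fun x : ℝ => riemannZeta₁ (1 + x))
    (differentiable_riemannZeta₁.continuous.comp (by fun_prop)).continuousOn
  refine ⟨|C| + 1, by positivity, fun x hx0 hx1 => ?_⟩
  have hx : (1 + x : ℂ) ≠ 1 := by simpa using hx0.ne'
  rw [riemannZeta_eq_inv_sub_mul hx, norm_mul, norm_inv, add_sub_cancel_left, norm_real,
    Real.norm_of_nonneg hx0.le, inv_mul_eq_div]
  gcongr
  linarith [hC x ⟨hx0.le, hx1⟩, le_abs_self C]

lemma one_le_norm_riemannZeta_product {x : ℝ} (hx : 0 < x) (y : ℝ) :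
    1 ≤ ‖riemannZeta (1 + x)‖ ^ 3 * ‖riemannZeta (1 + x + I * y)‖ ^ 4 *
      ‖riemannZeta (1 + x + 2 * I * y)‖ := by
  have := DirichletCharacter.norm_LFunction_product_ge_one (1 : DirichletCharacter ℂ 1) hx y
  rw [DirichletCharacter.LFunctionTrivChar, DirichletCharacter.LFunction_modOne_eq,
    DirichletCharacter.LFunction_modOne_eq] at this
  simpa using this

/-- A quantitative form of non-vanishing of `ζ` on `Re s ≥ 1`. -/
lemma exists_le_norm_riemannZeta {a : ℝ} (ha0 : 0 < a) (ha1 : a ≤ 1) :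
    ∃ c : ℝ, 0 < c ∧ ∀ s : ℂ, 1 < s.re → s.re ≤ 2 → 1 ≤ |s.im| →
      c / (|s.im| ^ a) ^ 4 ≤ ‖riemannZeta s‖ := by
  obtain ⟨C₀, hC₀, hb₀⟩ := exists_norm_riemannZeta_one_add_le
  obtain ⟨C₁, hC₁, hb₁⟩ := exists_norm_riemannZeta_le ha0 ha1
  obtain ⟨C₂, hC₂, hb₂⟩ := exists_norm_deriv_riemannZeta_le ha0 ha1
  -- the direct consequence of the `3-4-1` inequality
  have h341 : ∀ x : ℝ, 0 < x → x ≤ 1 → ∀ t : ℝ, 1 ≤ |t| →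
      x ^ 3 / (C₀ ^ 3 * C₁ * 2 ^ a * |t| ^ a) ≤ ‖riemannZeta (1 + x + I * t)‖ ^ 4 := by
    intro x hx0 hx1 t ht
    have h1 := one_le_norm_riemannZeta_product hx0 t
    have h2 := hb₀ x hx0 hx1
    have h3 := hb₁ (1 + x + 2 * I * t) (by simp; linarith) (by simp; linarith)
      (by simp [abs_mul]; linarith)
    have e : (1 + x + 2 * I * t : ℂ).im = 2 * t := by simp
    rw [e, abs_mul, abs_two, Real.mul_rpow (by norm_num) (abs_nonneg _)] at h3
    have hT : 0 < |t| ^ a := Real.rpow_pos_of_pos (by linarith) _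
    have h4 : (1 : ℝ) ≤ (C₀ / x) ^ 3 * ‖riemannZeta (1 + x + I * t)‖ ^ 4 *
        (C₁ * (2 ^ a * |t| ^ a)) := by
      refine h1.trans ?_
      gcongr
    rw [div_le_iff₀ (by positivity)]
    have h5 : (C₀ / x) ^ 3 * x ^ 3 = C₀ ^ 3 := by
      field_simp
    calc x ^ 3 = 1 * x ^ 3 := by ring
      _ ≤ ((C₀ / x) ^ 3 * ‖riemannZeta (1 + x + I * t)‖ ^ 4 * (C₁ * (2 ^ a * |t| ^ a))) * x ^ 3 := by
        gcongr
      _ = ‖riemannZeta (1 + x + I * t)‖ ^ 4 * ((C₀ / x) ^ 3 * x ^ 3 * C₁ * 2 ^ a * |t| ^ a) := by ring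
      _ = _ := by rw [h5]
  set K : ℝ := C₀ ^ 3 * C₁ * 2 ^ a with hK
  have hKpos : 0 < K := by positivity
  set δ : ℝ := min 1 (1 / (16 * C₂ ^ 4 * K)) with hδ
  have hδ0 : 0 < δ := by positivity
  have hδ1 : δ ≤ 1 := min_le_left _ _
  have hδ2 : δ * (16 * C₂ ^ 4 * K) ≤ 1 := by
    rw [← le_div_iff₀ (by positivity)]; exact min_le_right _ _
  set m : ℝ := (δ ^ 3 / K) ^ (1 / 4 : ℝ) with hm
  have hm0 : 0 < m := by positivity
  have hm4 : m ^ 4 = δ ^ 3 / K := by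
    rw [hm, ← Real.rpow_natCast, ← Real.rpow_mul (by positivity)]
    norm_num
  have hmδ : 2 * δ * C₂ ≤ m := by
    refine le_of_pow_le_pow_left₀ (n := 4) (by norm_num) hm0.le ?_
    rw [hm4, le_div_iff₀ hKpos]
    calc (2 * δ * C₂) ^ 4 * K = δ ^ 3 * (δ * (16 * C₂ ^ 4 * K)) := by ring
      _ ≤ δ ^ 3 * 1 := by gcongr
      _ = δ ^ 3 := by ring
  refine ⟨m / 2, by positivity, fun s hs1 hs2 ht => ?_⟩
  set t := s.im with ht'
  set T : ℝ := |t| ^ a with hT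
  have hT1 : 1 ≤ T := Real.one_le_rpow ht ha0.le
  have hT0 : 0 < T := by linarith
  set x : ℝ := δ / T ^ 5 with hx
  have hx0 : 0 < x := by positivity
  have hx1 : x ≤ 1 := by
    rw [hx, div_le_one (by positivity)]
    exact hδ1.trans (one_le_pow₀ hT1)
  have lower : ∀ y : ℝ, x ≤ y → y ≤ 1 → m / T ^ 4 ≤ ‖riemannZeta (1 + y + I * t)‖ := by
    intro y hy hy1
    refine le_of_pow_le_pow_left₀ (n := 4) (by norm_num) (norm_nonneg _) ?_
    refine le_trans ?_ (h341 y (hx0.trans_le hy) hy1 t ht)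
    calc (m / T ^ 4) ^ 4 = x ^ 3 / (K * T) := by
          rw [div_pow, hm4, hx]; field_simp
      _ ≤ y ^ 3 / (K * T) := by gcongr
  have es : s = 1 + ((s.re - 1 : ℝ) : ℂ) + I * t := by
    apply Complex.ext <;> simp [ht']
  rcases le_total x (s.re - 1) with h | h
  · have := lower _ h (by linarith)
    rw [← es] at this
    refine le_trans ?_ this
    gcongr
    linarith
  · have h1 := lower x le_rfl hx1
    set w : ℂ := 1 + x + I * t with hw
    have hwre : w.re = 1 + x := by simp [hw]
    have hwim : w.im = t := by simp [hw]
    have hseg : ∀ z ∈ segment ℝ s w, 1 ≤ z.re ∧ z.re ≤ 2 ∧ z.im = t := by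
      intro z hz
      have hz' := (((convex_halfSpace_re_ge 1).inter (convex_halfSpace_re_le 2)).inter
        ((convex_halfSpace_im_ge t).inter (convex_halfSpace_im_le t))).segment_subset
        (x := s) (y := w) ⟨⟨hs1.le, hs2⟩, ⟨le_refl t, le_refl t⟩⟩
        ⟨⟨show 1 ≤ w.re by rw [hwre]; linarith, show w.re ≤ 2 by rw [hwre]; linarith⟩,
          ⟨hwim.ge, hwim.le⟩⟩ hz
      exact ⟨hz'.1.1, hz'.1.2, le_antisymm hz'.2.2 hz'.2.1⟩
    have hdist := Convex.norm_image_sub_le_of_norm_deriv_le (𝕜 := ℂ) (f := riemannZeta)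
      (C := C₂ * T) (s := segment ℝ s w) (x := s) (y := w)
      (fun z hz => differentiableAt_riemannZeta (by
        rintro rfl
        have := (hseg 1 hz).2.2
        rw [← this] at ht
        norm_num at ht))
      (fun z hz => by
        obtain ⟨q1, q2, q3⟩ := hseg z hz
        have := hb₂ z (by linarith) (by linarith) (by rw [q3]; linarith)
        rwa [q3] at this)
      (convex_segment _ _) (left_mem_segment _ _ _) (right_mem_segment _ _ _)
    have hws : ‖w - s‖ ≤ x := by
      have : w - s = ((x - (s.re - 1) : ℝ) : ℂ) := by
        apply Complex.ext <;> simp [hw, ht'] ; ring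
      rw [this, norm_real, Real.norm_of_nonneg (by linarith)]
      linarith
    have h2 : ‖riemannZeta w‖ ≤ ‖riemannZeta s‖ + C₂ * T * x := by
      have := norm_le_insert' (riemannZeta w) (riemannZeta s)
      have h3 : C₂ * T * ‖w - s‖ ≤ C₂ * T * x := by gcongr
      linarith
    have h3 : C₂ * T * x ≤ m / 2 / T ^ 4 := by
      have : C₂ * T * x = δ * C₂ / T ^ 4 := by rw [hx]; field_simp
      rw [this]
      gcongr
      linarith
    have h4 : m / T ^ 4 = m / 2 / T ^ 4 + m / 2 / T ^ 4 := by ring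
    linarith
end

section
open Complex Set Topology

/-- The function `-ζ'/ζ - ζ`, with its removable singularity at `s = 1` filled in. -/
noncomputable def zetaLogDerivDiff (s : ℂ) : ℂ :=
  -(deriv riemannZeta₁ s / riemannZeta₁ s) - riemannZeta₀ s

lemma zetaLogDerivDiff_eq {s : ℂ} (hs : s ≠ 1) (hz : riemannZeta s ≠ 0) :
    zetaLogDerivDiff s = -deriv riemannZeta s / riemannZeta s - riemannZeta s := by
  have hs' : s - 1 ≠ 0 := sub_ne_zero.2 hs
  have h1 : riemannZeta₁ =ᶠ[𝓝 s] fun z => (z - 1) * riemannZeta z := by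
    filter_upwards [isOpen_ne.mem_nhds hs] with z hz
    rw [riemannZeta_eq_inv_sub_mul hz, mul_inv_cancel_left₀ (sub_ne_zero.2 hz)]
  have h2 : deriv riemannZeta₁ s = riemannZeta s + (s - 1) * deriv riemannZeta s := by
    rw [h1.deriv_eq]
    have := ((hasDerivAt_id s).sub_const 1).mul (differentiableAt_riemannZeta hs).hasDerivAt
    simpa using (show HasDerivAt (fun z : ℂ => (z - 1) * riemannZeta z) _ s from this).deriv
  have h3 : riemannZeta₀ s = riemannZeta s - (s - 1)⁻¹ := by
    rw [riemannZeta_eq_inv_sub_add hs]; ring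
  rw [zetaLogDerivDiff, h2, h1.self_of_nhds, h3]
  field_simp
  ring

lemma riemannZeta₁_ne_zero {s : ℂ} (hs : s = 1 ∨ riemannZeta s ≠ 0) : riemannZeta₁ s ≠ 0 := by
  by_cases h1 : s = 1
  · simp [h1]
  · intro h
    apply hs.resolve_left h1
    rw [riemannZeta_eq_inv_sub_mul h1, h, mul_zero]

lemma differentiableAt_zetaLogDerivDiff {s : ℂ} (hs : s = 1 ∨ riemannZeta s ≠ 0) :
    DifferentiableAt ℂ zetaLogDerivDiff s := by
  have h1 : DifferentiableAt ℂ (deriv riemannZeta₁) s :=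
    (differentiable_riemannZeta₁.analyticAt s).deriv.differentiableAt
  exact ((h1.div (differentiable_riemannZeta₁ s) (riemannZeta₁_ne_zero hs)).neg).sub
    (differentiable_riemannZeta₀ s)

lemma analyticAt_zetaLogDerivDiff {s : ℂ} (hs : 1 ≤ s.re) : AnalyticAt ℂ zetaLogDerivDiff s := by
  have h1 : AnalyticAt ℂ riemannZeta₁ s := differentiable_riemannZeta₁.analyticAt s
  exact ((h1.deriv.div h1 (riemannZeta₁_ne_zero
    (Or.inr (riemannZeta_ne_zero_of_one_le_re hs)))).neg).sub
    (differentiable_riemannZeta₀.analyticAt s)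

lemma exists_norm_iteratedDeriv_zetaLogDerivDiff_le_of_one_le_im (k : ℕ) :
    ∃ C : ℝ, 0 < C ∧ ∀ s : ℂ, 1 < s.re → s.re ≤ 2 → 1 ≤ |s.im| →
      ‖iteratedDeriv k zetaLogDerivDiff s‖ ≤ C * |s.im| ^ (1 / 2 : ℝ) := by
  set a : ℝ := 1 / (10 * (k + 1)) with ha
  have ha0 : 0 < a := by positivity
  have ha1 : a ≤ 1 := by
    rw [ha, div_le_one (by positivity)]
    linarith [(k.cast_nonneg : (0 : ℝ) ≤ k)]
  obtain ⟨C₁, hC₁, hb₁⟩ := exists_norm_riemannZeta_le ha0 ha1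
  obtain ⟨C₂, hC₂, hb₂⟩ := exists_norm_deriv_riemannZeta_le ha0 ha1
  obtain ⟨c, hc, hb₃⟩ := exists_le_norm_riemannZeta ha0 ha1
  set ρ : ℝ := min (a / 4) (c / (4 * C₂)) with hρ
  have hρ0 : 0 < ρ := by positivity
  have hρ1 : ρ ≤ a / 4 := min_le_left _ _
  have hρ2 : ρ * (4 * C₂) ≤ c := by
    rw [← le_div_iff₀ (by positivity)]; exact min_le_right _ _
  set D : ℝ := 2 * C₂ * 2 / c + 2 * C₁ with hD
  have hD0 : 0 < D := by positivity
  refine ⟨k.factorial * D / ρ ^ k, by positivity, fun s hs1 hs2 ht => ?_⟩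
  set T : ℝ := |s.im| ^ a with hT
  have hT1 : 1 ≤ T := Real.one_le_rpow ht ha0.le
  have hT0 : 0 < T := by linarith
  set r : ℝ := ρ / T ^ 5 with hr
  have hr0 : 0 < r := by positivity
  have hrρ : r ≤ ρ := div_le_self hρ0.le (one_le_pow₀ hT1)
  have hball : ∀ w ∈ Metric.closedBall s r,
      1 - a / 4 ≤ w.re ∧ w.re ≤ 5 / 2 ∧ 3 / 4 ≤ |w.im| ∧ |w.im| ≤ 2 * |s.im| := by
    intro w hw
    rw [mem_closedBall_iff_norm] at hw
    have hre := abs_le.1 ((abs_re_le_norm (w - s)).trans hw)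
    have him := (abs_im_le_norm (w - s)).trans hw
    simp only [sub_re, sub_im] at hre him
    have t1 := abs_sub_abs_le_abs_sub w.im s.im
    have t2 := abs_sub_abs_le_abs_sub s.im w.im
    rw [abs_sub_comm] at t2
    exact ⟨by linarith, by linarith, by linarith, by linarith⟩
  have hpow : ∀ w ∈ Metric.closedBall s r, |w.im| ^ a ≤ 2 * T := by
    intro w hw
    calc |w.im| ^ a ≤ (2 * |s.im|) ^ a := by
          gcongr; exact (hball w hw).2.2.2
      _ = 2 ^ a * T := Real.mul_rpow (by norm_num) (abs_nonneg _)
      _ ≤ 2 ^ (1 : ℝ) * T := by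
          gcongr; norm_num
      _ = 2 * T := by rw [Real.rpow_one]
  have hne1 : ∀ w ∈ Metric.closedBall s r, w ≠ 1 := by
    rintro w hw rfl
    have := (hball 1 hw).2.2.1
    norm_num at this
  have hder : ∀ w ∈ Metric.closedBall s r, ‖deriv riemannZeta w‖ ≤ C₂ * (2 * T) := by
    intro w hw
    obtain ⟨q1, q2, q3, -⟩ := hball w hw
    exact (hb₂ w q1 q2 q3).trans (by gcongr; exact hpow w hw)
  have hlow : ∀ w ∈ Metric.closedBall s r, c / 2 / T ^ 4 ≤ ‖riemannZeta w‖ := by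
    intro w hw
    have hdist := Convex.norm_image_sub_le_of_norm_deriv_le (𝕜 := ℂ) (f := riemannZeta)
      (fun z hz => differentiableAt_riemannZeta (hne1 z hz)) hder
      (convex_closedBall s r) (Metric.mem_closedBall_self hr0.le) hw
    have h1 : ‖w - s‖ ≤ r := by rwa [mem_closedBall_iff_norm] at hw
    have h2 : C₂ * (2 * T) * ‖w - s‖ ≤ C₂ * (2 * T) * r := by gcongr
    have h3 : C₂ * (2 * T) * r ≤ c / 2 / T ^ 4 := by
      have : C₂ * (2 * T) * r = 2 * C₂ * ρ / T ^ 4 := by rw [hr]; field_simp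
      rw [this]
      gcongr
      linarith
    have h4 := hb₃ s hs1 hs2 ht
    rw [← hT] at h4
    have h5 := norm_le_insert (riemannZeta w) (riemannZeta s)
    rw [norm_sub_rev] at hdist
    have h7 := norm_le_insert' (riemannZeta s) (riemannZeta w)
    have h6 : c / T ^ 4 = c / 2 / T ^ 4 + c / 2 / T ^ 4 := by ring
    linarith
  have hne0 : ∀ w ∈ Metric.closedBall s r, riemannZeta w ≠ 0 := by
    intro w hw h
    have := hlow w hw
    rw [h, norm_zero] at this
    have : 0 < c / 2 / T ^ 4 := by positivity
    linarith
  have hd : DiffContOnCl ℂ zetaLogDerivDiff (Metric.ball s r) :=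
    DifferentiableOn.diffContOnCl_ball (U := Metric.closedBall s r)
      (fun w hw => (differentiableAt_zetaLogDerivDiff
        (Or.inr (hne0 w hw))).differentiableWithinAt) subset_rfl
  have hfin := norm_iteratedDeriv_le_of_forall_mem_sphere_norm_le (C := D * T ^ 5) k hr0 hd
    fun w hw => ?_
  · refine hfin.trans (le_of_eq ?_)
    have e : |s.im| ^ (1 / 2 : ℝ) = T ^ (5 * (k + 1)) := by
      rw [hT, ← Real.rpow_natCast, ← Real.rpow_mul (abs_nonneg _)]
      congr 1
      rw [ha]; push_cast; field_simp; norm_num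
    rw [e, hr, div_pow]
    field_simp
    ring
  · have hw' := Metric.sphere_subset_closedBall hw
    rw [zetaLogDerivDiff_eq (hne1 w hw') (hne0 w hw')]
    refine (norm_sub_le _ _).trans ?_
    rw [norm_div, norm_neg]
    obtain ⟨q1, q2, q3, -⟩ := hball w hw'
    have h1 : ‖deriv riemannZeta w‖ / ‖riemannZeta w‖ ≤ C₂ * (2 * T) / (c / 2 / T ^ 4) := by
      gcongr
      · exact hder w hw'
      · exact hlow w hw'
    have h2 : ‖riemannZeta w‖ ≤ C₁ * (2 * T) :=
      (hb₁ w (by linarith) (by linarith) (by linarith)).trans (by gcongr; exact hpow w hw')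
    have h3 : C₂ * (2 * T) / (c / 2 / T ^ 4) = 2 * C₂ * 2 / c * T ^ 5 := by field_simp
    have h4 : C₁ * (2 * T) ≤ 2 * C₁ * T ^ 5 := by
      have : T ≤ T ^ 5 := le_self_pow₀ hT1 (by norm_num)
      nlinarith
    rw [hD]
    linarith

/-- Each derivative of `-ζ'/ζ - ζ` grows at most like `|Im s|^{1/2}` to the right of `Re s = 1`. -/
lemma exists_norm_iteratedDeriv_zetaLogDerivDiff_le (k : ℕ) :
    ∃ C : ℝ, 0 < C ∧ ∀ s : ℂ, 1 < s.re → s.re ≤ 2 →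
      ‖iteratedDeriv k zetaLogDerivDiff s‖ ≤ C * (1 + |s.im|) ^ (1 / 2 : ℝ) := by
  obtain ⟨C₁, hC₁, hb₁⟩ := exists_norm_iteratedDeriv_zetaLogDerivDiff_le_of_one_le_im k
  have hcont : ContinuousOn (iteratedDeriv k zetaLogDerivDiff) (Icc 1 2 ×ℂ Icc (-1) 1) := by
    intro s hs
    rw [iteratedDeriv_eq_iterate]
    exact ((analyticAt_zetaLogDerivDiff hs.1.1).iterated_deriv k).continuousAt.continuousWithinAt
  obtain ⟨C₂, hC₂⟩ := (isCompact_Icc.reProdIm isCompact_Icc).exists_bound_of_continuousOn hcont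
  refine ⟨C₁ + |C₂|, by positivity, fun s h1 h2 => ?_⟩
  have h3 : 1 ≤ (1 + |s.im|) ^ (1 / 2 : ℝ) :=
    Real.one_le_rpow (by linarith [abs_nonneg s.im]) (by norm_num)
  rcases le_total 1 |s.im| with h | h
  · refine (hb₁ s h1 h2 h).trans ?_
    gcongr
    · linarith [abs_nonneg C₂]
    · linarith
  · have := hC₂ s ⟨⟨h1.le, h2⟩, abs_le.1 h⟩
    have h4 := le_abs_self C₂
    have h5 := abs_nonneg C₂
    nlinarith

/-- The coefficients `(Λ(n) - 1) (log n)^k` for `n ≥ 1`. -/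
noncomputable def vonMangoldtDiffLog (k n : ℕ) : ℝ :=
  if n = 0 then 0 else (ArithmeticFunction.vonMangoldt n - 1) * Real.log n ^ k

lemma vonMangoldtDiffLog_abscissa (k : ℕ) :
    LSeries.abscissaOfAbsConv (fun n => (vonMangoldtDiffLog k n : ℂ)) ≤ 1 ∧
    ∀ s : ℂ, 1 < s.re → LSeries (fun n => (vonMangoldtDiffLog k n : ℂ)) s =
      (-1) ^ k * iteratedDeriv k zetaLogDerivDiff s := by
  set f : ℕ → ℂ := fun n => ((ArithmeticFunction.vonMangoldt n : ℝ) : ℂ) - 1 with hf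
  have hΛ : ∀ s : ℂ, 1 < s.re → LSeriesSummable f s := fun s hs =>
    (ArithmeticFunction.LSeriesSummable_vonMangoldt hs).sub (LSeriesSummable_one_iff.2 hs)
  have habs : LSeries.abscissaOfAbsConv f ≤ 1 :=
    LSeries.abscissaOfAbsConv_le_of_forall_lt_LSeriesSummable fun y hy => hΛ y (by simpa using hy)
  have hL : ∀ s : ℂ, 1 < s.re → LSeries f s = zetaLogDerivDiff s := by
    intro s hs
    have hs1 : s ≠ 1 := by rintro rfl; simp at hs
    rw [zetaLogDerivDiff_eq hs1 (riemannZeta_ne_zero_of_one_le_re hs.le),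
      ← ArithmeticFunction.LSeries_vonMangoldt_eq_deriv_riemannZeta_div hs,
      ← LSeries_one_eq_riemannZeta hs]
    exact LSeries_sub (ArithmeticFunction.LSeriesSummable_vonMangoldt hs)
      (LSeriesSummable_one_iff.2 hs)
  have hit : ∀ (k n : ℕ), (LSeries.logMul^[k] f) n = f n * (Real.log n : ℂ) ^ k := by
    intro k n
    induction k with
    | zero => simp
    | succ k ih =>
      rw [Function.iterate_succ_apply', LSeries.logMul, ih, ofReal_log n.cast_nonneg]
      push_cast; ring
  have hcongr : ∀ {n : ℕ}, n ≠ 0 → (vonMangoldtDiffLog k n : ℂ) = (LSeries.logMul^[k] f) n := by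
    intro n hn
    rw [hit, vonMangoldtDiffLog, if_neg hn, hf]
    push_cast; rfl
  constructor
  · rw [LSeries.abscissaOfAbsConv_congr hcongr, LSeries.absicssaOfAbsConv_logPowMul]
    exact habs
  · intro s hs
    rw [LSeries_congr hcongr]
    have h1 := LSeries_iteratedDeriv (f := f) k (s := s) (habs.trans_lt (by exact_mod_cast hs))
    have h2 : LSeries f =ᶠ[𝓝 s] zetaLogDerivDiff := by
      filter_upwards [(isOpen_lt continuous_const continuous_re).mem_nhds hs] with z hz
        using hL z hz
    rw [h2.iteratedDeriv_eq] at h1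
    rw [h1, ← mul_assoc, ← mul_pow]
    simp
end

section
open Complex Set Topology MeasureTheory

lemma hasMellin_max_one_sub {s : ℂ} (hs : 0 < s.re) :
    HasMellin (fun t : ℝ => ((max (1 - t) 0 : ℝ) : ℂ)) s (1 / s - 1 / (s + 1)) := by
  have h1 := hasMellin_one_Ioc hs
  have h2 := hasMellin_cpow_Ioc 1 (s := s) (by simp; linarith)
  have h3 := hasMellin_sub h1.1 h2.1
  rw [h1.2, h2.2] at h3
  have hcongr : ∀ t ∈ Ioi (0 : ℝ), (t : ℂ) ^ (s - 1) •
      (indicator (Ioc (0 : ℝ) 1) (fun _ => 1 : ℝ → ℂ) t -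
        indicator (Ioc (0 : ℝ) 1) (fun u : ℝ => (u : ℂ) ^ (1 : ℂ)) t)
        = (t : ℂ) ^ (s - 1) • ((max (1 - t) 0 : ℝ) : ℂ) := by
    intro t ht
    congr 1
    by_cases h : t ≤ 1
    · have hm : t ∈ Ioc (0 : ℝ) 1 := ⟨ht, h⟩
      rw [indicator_of_mem hm, indicator_of_mem hm, max_eq_left (by linarith)]
      push_cast; simp
    · have hm : t ∉ Ioc (0 : ℝ) 1 := fun h' => h h'.2
      rw [indicator_of_notMem hm, indicator_of_notMem hm, max_eq_right (by linarith)]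
      simp
  refine ⟨(integrableOn_congr_fun hcongr measurableSet_Ioi).1 h3.1, ?_⟩
  rw [← h3.2]
  exact (setIntegral_congr_fun measurableSet_Ioi hcongr).symm

lemma norm_one_div_sub_one_div_le {σ : ℝ} (hσ : 1 ≤ σ) (y : ℝ) :
    ‖1 / ((σ : ℂ) + y * I) - 1 / ((σ : ℂ) + y * I + 1)‖ ≤ (1 + y ^ 2)⁻¹ := by
  set s : ℂ := (σ : ℂ) + y * I with hs
  have hre : s.re = σ := by simp [hs]
  have him : s.im = y := by simp [hs]
  have h0 : s ≠ 0 := by intro h; rw [h] at hre; simp at hre; linarith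
  have h1 : s + 1 ≠ 0 := by
    intro h
    have : (s + 1).re = 0 := by rw [h]; simp
    simp [hre] at this; linarith
  have e : 1 / s - 1 / (s + 1) = (s * (s + 1))⁻¹ := by field_simp; ring
  rw [e, norm_inv, norm_mul]
  have n1 : ‖s‖ ^ 2 = σ ^ 2 + y ^ 2 := by
    rw [← normSq_eq_norm_sq, normSq_apply, hre, him]; ring
  have n2 : ‖s + 1‖ ^ 2 = (σ + 1) ^ 2 + y ^ 2 := by
    rw [← normSq_eq_norm_sq, normSq_apply]; simp [hre, him]; ring
  have h2 : 1 + y ^ 2 ≤ ‖s‖ * ‖s + 1‖ := by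
    have : ‖s‖ ≤ ‖s + 1‖ := by
      refine le_of_pow_le_pow_left₀ (n := 2) (by norm_num) (norm_nonneg _) ?_
      rw [n1, n2]; nlinarith
    nlinarith [norm_nonneg s]
  gcongr

lemma integrable_one_div_sub_one_div {σ : ℝ} (hσ : 1 ≤ σ) :
    Integrable fun y : ℝ => 1 / ((σ : ℂ) + y * I) - 1 / ((σ : ℂ) + y * I + 1) := by
  refine integrable_inv_one_add_sq.mono' ?_ (Eventually.of_forall (norm_one_div_sub_one_div_le hσ))
  refine Continuous.aestronglyMeasurable ?_
  have h0 : ∀ y : ℝ, (σ : ℂ) + y * I ≠ 0 := fun y h => by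
    have := congrArg re h; simp at this; linarith
  have h1 : ∀ y : ℝ, (σ : ℂ) + y * I + 1 ≠ 0 := fun y h => by
    have := congrArg re h; simp at this; linarith
  fun_prop (disch := assumption)

lemma max_one_sub_eq_integral {σ : ℝ} (hσ : 1 ≤ σ) {u : ℝ} (hu : 0 < u) :
    ((max (1 - u) 0 : ℝ) : ℂ) = (1 / (2 * Real.pi)) • ∫ y : ℝ, (u : ℂ) ^ (-((σ : ℂ) + y * I)) •
      (1 / ((σ : ℂ) + y * I) - 1 / ((σ : ℂ) + y * I + 1)) := by
  have hm : ∀ y : ℝ, mellin (fun t : ℝ => ((max (1 - t) 0 : ℝ) : ℂ)) ((σ : ℂ) + y * I)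
      = 1 / ((σ : ℂ) + y * I) - 1 / ((σ : ℂ) + y * I + 1) := fun y =>
    (hasMellin_max_one_sub (by simp; linarith)).2
  have := mellinInv_mellin_eq σ (fun t : ℝ => ((max (1 - t) 0 : ℝ) : ℂ)) hu
    (hasMellin_max_one_sub (by simp; linarith)).1 ?_ (by fun_prop)
  · rw [← this, mellinInv]
    simp only [hm]
  · simp only [VerticalIntegrable, hm]
    exact integrable_one_div_sub_one_div hσ

/-- A smoothed Perron-type inequality: growth of a Dirichlet series on a vertical line controls
the Cesàro means of its coefficients. -/
lemma exists_norm_tsum_mul_max_le :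
    ∃ K : ℝ, 0 < K ∧ ∀ (b : ℕ → ℂ) (σ x B : ℝ), b 0 = 0 → 1 ≤ σ → 0 < x →
      LSeriesSummable b σ →
      (∀ y : ℝ, ‖LSeries b (σ + y * I)‖ ≤ B * (1 + |y|) ^ (1 / 2 : ℝ)) →
      ‖∑' n : ℕ, b n * ((max (1 - n / x) 0 : ℝ) : ℂ)‖ ≤ K * B * x ^ σ := by
  have hint : Integrable fun y : ℝ => (1 + ‖y‖) ^ (-(3 / 2 : ℝ)) :=
    integrable_one_add_norm (by norm_num)
  set J : ℝ := ∫ y : ℝ, (1 + ‖y‖) ^ (-(3 / 2 : ℝ)) with hJ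
  have hJ0 : 0 ≤ J := integral_nonneg fun y => by positivity
  refine ⟨1 / (2 * Real.pi) * (2 * J) + 1, by positivity, ?_⟩
  intro b σ x B hb0 hσ hx hsum hB
  set M : ℝ → ℂ := fun y => 1 / ((σ : ℂ) + y * I) - 1 / ((σ : ℂ) + y * I + 1) with hM
  have hMint : Integrable M := integrable_one_div_sub_one_div hσ
  set F : ℕ → ℝ → ℂ := fun n y => LSeries.term b (σ + y * I) n * ((x : ℂ) ^ ((σ : ℂ) + y * I) * M y)
    with hF
  have hx0 : (x : ℂ) ≠ 0 := ofReal_ne_zero.2 hx.ne'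
  have hnx : ∀ y : ℝ, ‖(x : ℂ) ^ ((σ : ℂ) + y * I)‖ = x ^ σ := fun y => by
    rw [norm_cpow_eq_rpow_re_of_pos hx]; simp
  have hnt : ∀ (n : ℕ) (y : ℝ), ‖LSeries.term b (σ + y * I) n‖ = ‖LSeries.term b σ n‖ := by
    intro n y
    rw [LSeries.norm_term_eq, LSeries.norm_term_eq]
    simp
  have hFeq : ∀ (n : ℕ), n ≠ 0 → ∀ y : ℝ,
      F n y = b n * (((n / x : ℝ) : ℂ) ^ (-((σ : ℂ) + y * I)) • M y) := by
    intro n hn y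
    have hn' : (0 : ℝ) ≤ n := n.cast_nonneg
    simp only [hF]
    rw [LSeries.term_of_ne_zero hn, smul_eq_mul, div_eq_mul_inv (n : ℝ), ofReal_mul,
      mul_cpow_ofReal_nonneg hn' (by positivity), cpow_neg, ofReal_inv, ofReal_natCast,
      inv_cpow _ _ (by rw [arg_ofReal_of_nonneg hx.le]; exact Real.pi_ne_zero.symm), cpow_neg,
      inv_inv]
    ring
  have hFint : ∀ n, Integrable (F n) := by
    intro n
    rcases eq_or_ne n 0 with rfl | hn
    · simp [hF]
    · have hu : ((n / x : ℝ) : ℂ) ≠ 0 := ofReal_ne_zero.2 (by positivity)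
      have hc : Continuous fun y : ℝ => ((n / x : ℝ) : ℂ) ^ (-((σ : ℂ) + y * I)) := by
        refine Continuous.const_cpow (by fun_prop) (Or.inl hu)
      refine (Integrable.congr ?_ (Eventually.of_forall fun y => (hFeq n hn y).symm))
      refine Integrable.const_mul ?_ _
      refine hMint.bdd_mul (c := (n / x : ℝ) ^ (-σ)) hc.aestronglyMeasurable ?_
      refine Eventually.of_forall fun y => ?_
      rw [norm_cpow_eq_rpow_re_of_pos (by positivity)]
      simp
  have hFnorm : ∀ n, ∫ y, ‖F n y‖ = ‖LSeries.term b σ n‖ * (x ^ σ * ∫ y, ‖M y‖) := by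
    intro n
    simp only [hF, norm_mul, hnx, hnt]
    rw [integral_const_mul, integral_const_mul]
  have hFs : Summable fun n => ∫ y, ‖F n y‖ := by
    simp only [hFnorm]
    exact hsum.norm.mul_right _
  have hhs := hasSum_integral_of_summable_integral_norm hFint hFs
  have hterm : ∀ n : ℕ, b n * ((max (1 - n / x) 0 : ℝ) : ℂ) = (1 / (2 * Real.pi)) • ∫ y, F n y := by
    intro n
    rcases eq_or_ne n 0 with rfl | hn
    · simp [hb0, hF]
    · rw [max_one_sub_eq_integral hσ (show 0 < (n / x : ℝ) by positivity)]
      simp only [hFeq n hn]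
      rw [integral_const_mul, mul_smul_comm]
  have htsum : ∀ y : ℝ, ∑' n, F n y = LSeries b (σ + y * I) * ((x : ℂ) ^ ((σ : ℂ) + y * I) * M y) := by
    intro y
    simp only [hF]
    rw [tsum_mul_right, LSeries]
  rw [tsum_congr hterm, (hhs.const_smul (1 / (2 * Real.pi))).tsum_eq, norm_smul,
    Real.norm_of_nonneg (by positivity)]
  have hB0 : 0 ≤ B := by
    have := (norm_nonneg _).trans (hB 0)
    simpa using this
  have hbound : ‖∫ y, ∑' n, F n y‖ ≤ ∫ y : ℝ, (2 * B * x ^ σ) * (1 + ‖y‖) ^ (-(3 / 2 : ℝ)) := by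
    refine norm_integral_le_of_norm_le (hint.const_mul (2 * B * x ^ σ)) ?_
    refine Eventually.of_forall fun y => ?_
    rw [htsum, norm_mul, norm_mul, hnx]
    have h1 := norm_one_div_sub_one_div_le hσ y
    have h2 : (1 + y ^ 2)⁻¹ ≤ 2 * (1 + |y|) ^ (-2 : ℝ) := by
      rw [Real.rpow_neg (by positivity), ← div_eq_mul_inv, inv_eq_one_div,
        div_le_div_iff₀ (by positivity) (by positivity), Real.rpow_two]
      nlinarith [sq_abs y, sq_nonneg (|y| - 1)]
    have h3 : (1 + |y|) ^ (1 / 2 : ℝ) * (1 + |y|) ^ (-2 : ℝ) = (1 + ‖y‖) ^ (-(3 / 2 : ℝ)) := by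
      rw [← Real.rpow_add (by positivity), Real.norm_eq_abs]; norm_num
    calc ‖LSeries b (σ + y * I)‖ * (x ^ σ * ‖M y‖)
        ≤ B * (1 + |y|) ^ (1 / 2 : ℝ) * (x ^ σ * (2 * (1 + |y|) ^ (-2 : ℝ))) := by
          gcongr
          · exact hB y
          · exact h1.trans h2
      _ = 2 * B * x ^ σ * ((1 + |y|) ^ (1 / 2 : ℝ) * (1 + |y|) ^ (-2 : ℝ)) := by ring
      _ = _ := by rw [h3]
  rw [integral_const_mul, ← hJ] at hbound
  have h5 : 0 ≤ B * x ^ σ := by positivity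
  calc 1 / (2 * Real.pi) * ‖∫ y, ∑' n, F n y‖
      ≤ 1 / (2 * Real.pi) * (2 * B * x ^ σ * J) := by gcongr
    _ ≤ _ := by nlinarith

/-- Cesàro means of `(Λ(n) - 1) (log n)^k` are bounded. -/
lemma exists_abs_tsum_vonMangoldtDiffLog_le (k : ℕ) :
    ∃ C : ℝ, 0 < C ∧ ∀ x : ℝ, Real.exp 1 ≤ x →
      |∑' n : ℕ, vonMangoldtDiffLog k n * max (1 - n / x) 0| ≤ C * x := by
  obtain ⟨K, hK, h⟩ := exists_norm_tsum_mul_max_le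
  obtain ⟨B, hB, hb⟩ := exists_norm_iteratedDeriv_zetaLogDerivDiff_le k
  obtain ⟨h1, h2⟩ := vonMangoldtDiffLog_abscissa k
  refine ⟨K * B * Real.exp 1, by positivity, fun x hx => ?_⟩
  have hx0 : 0 < x := (Real.exp_pos 1).trans_le hx
  have hlog : 1 ≤ Real.log x := (Real.le_log_iff_exp_le hx0).2 hx
  set σ : ℝ := 1 + 1 / Real.log x with hσ
  have hσ1 : 1 < σ := by
    have : 0 < 1 / Real.log x := by positivity
    linarith
  have hσ2 : σ ≤ 2 := by
    have : 1 / Real.log x ≤ 1 := by rw [div_le_one (by linarith)]; exact hlog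
    linarith
  have := h (fun n => (vonMangoldtDiffLog k n : ℂ)) σ x B (by simp [vonMangoldtDiffLog]) hσ1.le hx0
    (LSeriesSummable_of_abscissaOfAbsConv_lt_re (h1.trans_lt (by simpa using mod_cast hσ1)))
    (fun y => by
      rw [h2 _ (by simpa using hσ1), norm_mul]
      have := hb (σ + y * I) (by simpa using hσ1) (by simpa using hσ2)
      simpa using this)
  have hxσ : x ^ σ = Real.exp 1 * x := by
    rw [hσ, Real.rpow_add hx0, Real.rpow_one, one_div, mul_comm, Real.rpow_def_of_pos hx0,
      mul_inv_cancel₀ (by linarith)]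
  rw [hxσ] at this
  have e : ∑' n : ℕ, (vonMangoldtDiffLog k n : ℂ) * ((max (1 - n / x) 0 : ℝ) : ℂ)
      = ((∑' n : ℕ, vonMangoldtDiffLog k n * max (1 - n / x) 0 : ℝ) : ℂ) := by
    push_cast; rfl
  rw [e, norm_real, Real.norm_eq_abs] at this
  linarith
end

section
open Finset

lemma sum_Icc_zero_eq_add_sum_Ioc (f : ℕ → ℝ) {a b : ℕ} (hab : a ≤ b) :
    ∑ n ∈ Icc 0 b, f n = ∑ n ∈ Icc 0 a, f n + ∑ n ∈ Ioc a b, f n := by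
  rw [← add_sum_Ioc_eq_sum_Icc (Nat.zero_le b), ← add_sum_Ioc_eq_sum_Icc (Nat.zero_le a),
    ← sum_Ioc_consecutive f (Nat.zero_le a) hab, add_assoc]

/-- The difference of Riesz means over `[x, x + h]` controls the partial sums at both endpoints,
for coefficients that are bounded below. -/
lemma mul_sum_le_and_le_mul_sum (d : ℕ → ℝ) {x h l : ℝ} (hx : 0 ≤ x) (hh : 0 ≤ h) (hl : 0 ≤ l)
    (hd : ∀ n ∈ Ioc ⌊x⌋₊ ⌊x + h⌋₊, -l ≤ d n) :
    h * ∑ n ∈ Icc 0 ⌊x⌋₊, d n ≤ ∑ n ∈ Icc 0 ⌊x + h⌋₊, d n * (x + h - n)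
        - ∑ n ∈ Icc 0 ⌊x⌋₊, d n * (x - n) + h * (h + 1) * l ∧
    ∑ n ∈ Icc 0 ⌊x + h⌋₊, d n * (x + h - n) - ∑ n ∈ Icc 0 ⌊x⌋₊, d n * (x - n)
        - h * (h + 1) * l ≤ h * ∑ n ∈ Icc 0 ⌊x + h⌋₊, d n := by
  have hab : ⌊x⌋₊ ≤ ⌊x + h⌋₊ := Nat.floor_le_floor (by linarith)
  have hcard : ((Ioc ⌊x⌋₊ ⌊x + h⌋₊).card : ℝ) ≤ h + 1 := by
    rw [Nat.card_Ioc, Nat.cast_sub hab]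
    have h1 := Nat.floor_le (show 0 ≤ x + h by linarith)
    have h2 := Nat.lt_floor_add_one x
    linarith
  have hlow : ∀ w : ℕ → ℝ, (∀ n ∈ Ioc ⌊x⌋₊ ⌊x + h⌋₊, 0 ≤ w n ∧ w n ≤ h) →
      -(h * (h + 1) * l) ≤ ∑ n ∈ Ioc ⌊x⌋₊ ⌊x + h⌋₊, d n * w n := by
    intro w hw
    have : ∑ n ∈ Ioc ⌊x⌋₊ ⌊x + h⌋₊, (-(l * h)) ≤ ∑ n ∈ Ioc ⌊x⌋₊ ⌊x + h⌋₊, d n * w n := by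
      refine sum_le_sum fun n hn => ?_
      obtain ⟨h1, h2⟩ := hw n hn
      have h3 := hd n hn
      nlinarith [mul_le_mul_of_nonneg_left h2 hl, mul_nonneg (by linarith : 0 ≤ d n + l) h1]
    rw [sum_const, nsmul_eq_mul] at this
    have h4 : 0 ≤ l * h := mul_nonneg hl hh
    nlinarith [mul_le_mul_of_nonneg_right hcard h4]
  have hmem : ∀ n ∈ Ioc ⌊x⌋₊ ⌊x + h⌋₊, x < n ∧ (n : ℝ) ≤ x + h := by
    intro n hn
    rw [mem_Ioc] at hn
    exact ⟨(Nat.floor_lt hx).1 hn.1, (Nat.le_floor_iff (by linarith)).1 hn.2⟩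
  rw [sum_Icc_zero_eq_add_sum_Ioc _ hab, sum_Icc_zero_eq_add_sum_Ioc _ hab]
  have e : ∑ n ∈ Icc 0 ⌊x⌋₊, d n * (x + h - n)
      = ∑ n ∈ Icc 0 ⌊x⌋₊, d n * (x - n) + h * ∑ n ∈ Icc 0 ⌊x⌋₊, d n := by
    rw [mul_sum, ← sum_add_distrib]
    exact sum_congr rfl fun n _ => by ring
  constructor
  · have := hlow (fun n => x + h - n) fun n hn => by
      have := hmem n hn
      constructor <;> linarith
    linarith
  · have := hlow (fun n => n - x) fun n hn => by
      have := hmem n hn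
      constructor <;> linarith
    have e2 : h * ∑ n ∈ Ioc ⌊x⌋₊ ⌊x + h⌋₊, d n = ∑ n ∈ Ioc ⌊x⌋₊ ⌊x + h⌋₊, d n * (x + h - n)
        + ∑ n ∈ Ioc ⌊x⌋₊ ⌊x + h⌋₊, d n * (n - x) := by
      rw [mul_sum, ← sum_add_distrib]
      exact sum_congr rfl fun n _ => by ring
    linarith

lemma tsum_mul_max_eq_sum (d : ℕ → ℝ) {x : ℝ} (hx : 0 < x) :
    x * ∑' n : ℕ, d n * max (1 - n / x) 0 = ∑ n ∈ Icc 0 ⌊x⌋₊, d n * (x - n) := by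
  rw [tsum_eq_sum (s := Icc 0 ⌊x⌋₊), mul_sum]
  · refine sum_congr rfl fun n hn => ?_
    have h1 : (n : ℝ) ≤ x := (Nat.le_floor_iff hx.le).1 (mem_Icc.1 hn).2
    rw [max_eq_left]
    · field_simp
    · rw [sub_nonneg, div_le_one hx]; exact h1
  · intro n hn
    have h1 : x < n := by
      rw [mem_Icc, not_and] at hn
      exact (Nat.floor_lt hx.le).1 (not_le.1 (hn (Nat.zero_le n)))
    rw [max_eq_right, mul_zero]
    rw [sub_nonpos, one_le_div hx]; exact h1.le

lemma neg_log_pow_le_vonMangoldtDiffLog (k n : ℕ) :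
    -Real.log n ^ k ≤ vonMangoldtDiffLog k n := by
  have h0 : 0 ≤ Real.log n ^ k := pow_nonneg (Real.log_natCast_nonneg n) k
  unfold vonMangoldtDiffLog
  split_ifs with h
  · linarith
  · nlinarith [ArithmeticFunction.vonMangoldt_nonneg (n := n)]

lemma log_pow_le_factorial_mul {x : ℝ} (hx : 1 ≤ x) (m : ℕ) :
    Real.log x ^ m ≤ m.factorial * x := by
  have h := Real.pow_div_factorial_le_exp (Real.log x) (Real.log_nonneg hx) m
  rw [Real.exp_log (by linarith), div_le_iff₀ (by positivity)] at h
  linarith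

lemma exists_abs_sum_vonMangoldtDiffLog_le (m : ℕ) :
    ∃ C : ℝ, 0 < C ∧ ∀ x : ℝ, Real.exp 2 ≤ x →
      |∑ n ∈ Icc 0 ⌊x⌋₊, vonMangoldtDiffLog (2 * m) n| ≤ C * x * Real.log x ^ m := by
  obtain ⟨C, hC, hT⟩ := exists_abs_tsum_vonMangoldtDiffLog_le (2 * m)
  set d := vonMangoldtDiffLog (2 * m) with hd
  have hR : ∀ x : ℝ, Real.exp 1 ≤ x → |∑ n ∈ Icc 0 ⌊x⌋₊, d n * (x - n)| ≤ C * x ^ 2 := by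
    intro x hx
    have hx0 : 0 < x := (Real.exp_pos 1).trans_le hx
    rw [← tsum_mul_max_eq_sum d hx0, abs_mul, abs_of_pos hx0]
    nlinarith [mul_le_mul_of_nonneg_left (hT x hx) hx0.le]
  refine ⟨10 * C + 2 ^ (2 * m) * (1 + m.factorial), by positivity, fun x hx => ?_⟩
  have he : 2 * Real.exp 1 ≤ Real.exp 2 := by
    rw [show (2 : ℝ) = 1 + 1 by norm_num, Real.exp_add]
    nlinarith [Real.add_one_le_exp 1, Real.exp_pos 1]
  have hx0 : 0 < x := (Real.exp_pos 2).trans_le hx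
  have hx1 : 1 ≤ x := by linarith [Real.add_one_le_exp 2]
  have hlog : 2 ≤ Real.log x := (Real.le_log_iff_exp_le hx0).2 hx
  set L := Real.log x with hL
  have hLm : 1 ≤ L ^ m := one_le_pow₀ (by linarith)
  set h : ℝ := x / (2 * L ^ m) with hh
  have hh0 : 0 < h := by positivity
  have hhx : h ≤ x / 2 := by
    rw [hh]; gcongr; linarith
  have hhL : h * L ^ m = x / 2 := by rw [hh]; field_simp
  have hlow : ∀ n : ℕ, (n : ℝ) ≤ 2 * x → -(2 * L) ^ (2 * m) ≤ d n := by
    intro n hn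
    refine le_trans ?_ (neg_log_pow_le_vonMangoldtDiffLog (2 * m) n)
    refine neg_le_neg (pow_le_pow_left₀ (Real.log_natCast_nonneg n) ?_ _)
    rcases n.eq_zero_or_pos with rfl | hn0
    · simp; linarith
    · calc Real.log n ≤ Real.log (2 * x) := Real.log_le_log (by exact_mod_cast hn0) hn
        _ = Real.log 2 + L := Real.log_mul (by norm_num) hx0.ne'
        _ ≤ 2 * L := by linarith [Real.log_two_lt_d9]
  have hl : 0 ≤ (2 * L) ^ (2 * m) := by positivity
  have hup := (mul_sum_le_and_le_mul_sum d hx0.le hh0.le hl fun n hn => hlow n <| by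
    have := (Nat.le_floor_iff (by linarith)).1 (mem_Ioc.1 hn).2
    linarith).1
  have hdn := (mul_sum_le_and_le_mul_sum d (x := x - h) (by linarith) hh0.le hl fun n hn =>
    hlow n <| by
      have := (Nat.le_floor_iff (by linarith)).1 (mem_Ioc.1 hn).2
      linarith).2
  rw [sub_add_cancel] at hdn
  have r1 := abs_le.1 (hR (x + h) (by linarith))
  have r2 := abs_le.1 (hR x (by linarith))
  have r3 := abs_le.1 (hR (x - h) (by linarith))
  have q1 : C * (x + h) ^ 2 ≤ C * (4 * x ^ 2) := by gcongr; nlinarith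
  have q3 : C * (x - h) ^ 2 ≤ C * x ^ 2 := by gcongr <;> linarith
  have hfac : L ^ m ≤ m.factorial * x := log_pow_le_factorial_mul hx1 m
  have hmain : (h + 1) * (2 * L) ^ (2 * m) ≤ 2 ^ (2 * m) * (1 + m.factorial) * x * L ^ m := by
    have e : (2 * L) ^ (2 * m) = 2 ^ (2 * m) * (L ^ m * L ^ m) := by
      rw [mul_pow, two_mul m, pow_add L]
    rw [e]
    have : (h + 1) * (L ^ m * L ^ m) ≤ (1 + m.factorial) * x * L ^ m := by
      have : (h + 1) * L ^ m ≤ (1 + m.factorial) * x := by nlinarith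
      calc _ = (h + 1) * L ^ m * L ^ m := by ring
        _ ≤ _ := by gcongr
    calc _ = 2 ^ (2 * m) * ((h + 1) * (L ^ m * L ^ m)) := by ring
      _ ≤ 2 ^ (2 * m) * ((1 + m.factorial) * x * L ^ m) := by gcongr
      _ = _ := by ring
  have hmain' := mul_le_mul_of_nonneg_left hmain hh0.le
  have hC5 : 5 * C * x ^ 2 = h * (10 * C * x * L ^ m) := by
    calc _ = 10 * C * x * (x / 2) := by ring
      _ = _ := by rw [← hhL]; ring
  rw [abs_le]
  constructor
  · refine le_of_mul_le_mul_left ?_ hh0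
    nlinarith
  · refine le_of_mul_le_mul_left ?_ hh0
    nlinarith
end

section
open Finset ArithmeticFunction

lemma abs_sum_log_pow_sub_integral_le (k : ℕ) {x : ℝ} (hx : 1 ≤ x) :
    |∑ n ∈ Ioc 0 ⌊x⌋₊, Real.log n ^ k - ∫ u in (1 : ℝ)..x, Real.log u ^ k|
      ≤ 2 * Real.log x ^ k + 1 := by
  have hmono : MonotoneOn (fun u : ℝ => Real.log u ^ k) (Set.Ici 1) := fun u hu v hv huv =>
    pow_le_pow_left₀ (Real.log_nonneg hu) (Real.log_le_log (by linarith [Set.mem_Ici.1 hu]) huv) k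
  have hint : ∀ a b : ℝ, 1 ≤ a → 1 ≤ b →
      IntervalIntegrable (fun u : ℝ => Real.log u ^ k) MeasureTheory.volume a b := by
    intro a b ha hb
    refine (hmono.mono fun u hu => ?_).intervalIntegrable
    exact (le_min ha hb).trans hu.1
  set X := ⌊x⌋₊ with hX
  have hX1 : 1 ≤ X := Nat.le_floor (by simpa using hx)
  have hXx : (X : ℝ) ≤ x := Nat.floor_le (by linarith)
  have hxX : x < X + 1 := Nat.lt_floor_add_one x
  have hX1' : (1 : ℝ) ≤ X := by exact_mod_cast hX1
  have hsub : Set.Icc ((1 : ℕ) : ℝ) X ⊆ Set.Ici 1 := fun u hu => by simpa using hu.1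
  have h1 := MonotoneOn.sum_le_integral_Ico hX1 (hmono.mono hsub)
  have h2 := MonotoneOn.integral_le_sum_Ico hX1 (hmono.mono hsub)
  rw [Nat.cast_one] at h1 h2
  have hlogX : Real.log X ^ k ≤ Real.log x ^ k := hmono hX1' hx hXx
  have h3 : ∑ n ∈ Ioc 0 X, Real.log n ^ k = ∑ n ∈ Ico 1 X, Real.log n ^ k + Real.log X ^ k := by
    rw [← sum_Ico_succ_top hX1]
    rfl
  have h4 : ∑ n ∈ Ioc 0 X, Real.log n ^ k
      = Real.log 1 ^ k + ∑ n ∈ Ico 1 X, Real.log ((n + 1 : ℕ) : ℝ) ^ k := by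
    rw [sum_Ico_add' (fun n : ℕ => Real.log n ^ k) 1 X 1]
    have : Ioc 0 X = Ico 1 (X + 1) := rfl
    rw [this, sum_eq_sum_Ico_succ_bot (by omega)]
    simp
  have h5 : Real.log 1 ^ k ≤ 1 := by
    rw [Real.log_one]; exact pow_le_one₀ le_rfl zero_le_one
  have h5' : 0 ≤ Real.log 1 ^ k := by rw [Real.log_one]; positivity
  have h6 : 0 ≤ ∫ u in (X : ℝ)..x, Real.log u ^ k :=
    intervalIntegral.integral_nonneg hXx fun u hu =>
      pow_nonneg (Real.log_nonneg (hX1'.trans hu.1)) k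
  have h7 : ∫ u in (X : ℝ)..x, Real.log u ^ k ≤ Real.log x ^ k := by
    calc _ ≤ ∫ u in (X : ℝ)..x, Real.log x ^ k := by
          refine intervalIntegral.integral_mono_on hXx (hint _ _ hX1' hx) (by simp) fun u hu => ?_
          exact hmono (hX1'.trans hu.1) hx hu.2
      _ = (x - X) * Real.log x ^ k := by simp
      _ ≤ 1 * Real.log x ^ k := by
          refine mul_le_mul_of_nonneg_right (by linarith) (pow_nonneg (Real.log_nonneg hx) k)
      _ = _ := one_mul _
  have h8 := intervalIntegral.integral_add_adjacent_intervals (hint 1 X le_rfl hX1')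
    (hint X x hX1' hx)
  rw [abs_le]
  constructor <;> linarith

lemma exists_sum_vonMangoldt_mul_log_pow_sub_le :
    ∃ C : ℝ, 0 < C ∧ ∀ (m : ℕ) (x : ℝ), 1 ≤ x →
      |∑ n ∈ Ioc 0 ⌊x⌋₊, Λ n * Real.log n ^ (2 * m)
        - ∑ n ∈ Ioc 0 ⌊x⌋₊, (if n.Prime then Real.log n ^ (2 * m + 1) else 0)|
      ≤ C * (2 ^ m * m.factorial) * x * Real.log x ^ m := by
  obtain ⟨C, hC⟩ := Chebyshev.psi_sub_theta_le_mul_sqrt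
  refine ⟨max C 1, by positivity, fun m x hx => ?_⟩
  have e : ∑ n ∈ Ioc 0 ⌊x⌋₊, Λ n * Real.log n ^ (2 * m)
      - ∑ n ∈ Ioc 0 ⌊x⌋₊, (if n.Prime then Real.log n ^ (2 * m + 1) else 0)
      = ∑ n ∈ Ioc 0 ⌊x⌋₊ with ¬ n.Prime, Λ n * Real.log n ^ (2 * m) := by
    rw [sum_filter, ← sum_sub_distrib]
    refine sum_congr rfl fun n _ => ?_
    by_cases h : n.Prime
    · simp [h, vonMangoldt_apply_prime]; ring
    · simp [h]
  have hL : 0 ≤ Real.log x := Real.log_nonneg hx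
  have hnn : 0 ≤ ∑ n ∈ Ioc 0 ⌊x⌋₊ with ¬ n.Prime, Λ n * Real.log n ^ (2 * m) :=
    sum_nonneg fun n _ => mul_nonneg vonMangoldt_nonneg
      (pow_nonneg (Real.log_natCast_nonneg n) _)
  have hsq : Real.log x ^ m ≤ 2 ^ m * m.factorial * √x := by
    have h1 : 1 ≤ √x := Real.one_le_sqrt.2 hx
    have h2 := log_pow_le_factorial_mul h1 m
    rw [Real.log_sqrt (by linarith), div_pow, div_le_iff₀ (by positivity)] at h2
    linarith
  rw [e, abs_of_nonneg hnn]
  have hmax : (0 : ℝ) ≤ max C 1 := by positivity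
  calc _ ≤ ∑ n ∈ Ioc 0 ⌊x⌋₊ with ¬ n.Prime, Λ n * Real.log x ^ (2 * m) := by
        refine sum_le_sum fun n hn => ?_
        have hn := mem_Ioc.1 (mem_filter.1 hn).1
        refine mul_le_mul_of_nonneg_left ?_ vonMangoldt_nonneg
        refine pow_le_pow_left₀ (Real.log_natCast_nonneg n) ?_ _
        refine Real.log_le_log (by exact_mod_cast hn.1) ?_
        exact (Nat.le_floor_iff (by linarith)).1 hn.2
    _ = (Chebyshev.psi x - Chebyshev.theta x) * Real.log x ^ (2 * m) := by
        rw [Chebyshev.psi_sub_theta_eq_sum_not_prime, sum_mul]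
    _ ≤ (max C 1 * √x) * (Real.log x ^ m * Real.log x ^ m) := by
        rw [two_mul m, pow_add]
        refine mul_le_mul_of_nonneg_right ((hC x).trans ?_) (by positivity)
        gcongr
        exact le_max_left _ _
    _ ≤ (max C 1 * √x) * ((2 ^ m * m.factorial * √x) * Real.log x ^ m) := by gcongr
    _ = max C 1 * (2 ^ m * m.factorial) * (√x * √x) * Real.log x ^ m := by ring
    _ = _ := by rw [Real.mul_self_sqrt (by linarith)]

/-- A form of the prime number theorem with error term saving an arbitrary power of `log x`. -/
lemma exists_abs_sum_prime_log_pow_sub_integral_le (m : ℕ) :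
    ∃ C : ℝ, 0 < C ∧ ∀ x : ℝ, Real.exp 2 ≤ x →
      |∑ n ∈ Icc 0 ⌊x⌋₊, (if n.Prime then Real.log n ^ (2 * m + 1) else 0)
        - ∫ u in (1 : ℝ)..x, Real.log u ^ (2 * m)| ≤ C * x * Real.log x ^ m := by
  obtain ⟨C₁, hC₁, h₁⟩ := exists_abs_sum_vonMangoldtDiffLog_le m
  obtain ⟨C₂, hC₂, h₂⟩ := exists_sum_vonMangoldt_mul_log_pow_sub_le
  refine ⟨C₁ + C₂ * (2 ^ m * m.factorial) + (2 * m.factorial + 1), by positivity, fun x hx => ?_⟩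
  have hx0 : 0 < x := (Real.exp_pos 2).trans_le hx
  have hx1 : 1 ≤ x := by linarith [Real.add_one_le_exp 2]
  have hlog : 2 ≤ Real.log x := (Real.le_log_iff_exp_le hx0).2 hx
  have hLm : 1 ≤ Real.log x ^ m := one_le_pow₀ (by linarith)
  have a1 := abs_le.1 (h₁ x hx)
  have a2 := abs_le.1 (h₂ m x hx1)
  have a3 := abs_le.1 (abs_sum_log_pow_sub_integral_le (2 * m) hx1)
  have a4 : 2 * Real.log x ^ (2 * m) + 1 ≤ (2 * m.factorial + 1) * x * Real.log x ^ m := by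
    have := log_pow_le_factorial_mul hx1 m
    rw [two_mul m, pow_add]
    nlinarith [mul_le_mul hx1 hLm zero_le_one (by linarith)]
  have e1 : ∑ n ∈ Icc 0 ⌊x⌋₊, vonMangoldtDiffLog (2 * m) n
      = ∑ n ∈ Ioc 0 ⌊x⌋₊, Λ n * Real.log n ^ (2 * m) - ∑ n ∈ Ioc 0 ⌊x⌋₊, Real.log n ^ (2 * m) := by
    rw [← add_sum_Ioc_eq_sum_Icc (Nat.zero_le _), ← sum_sub_distrib]
    have : vonMangoldtDiffLog (2 * m) 0 = 0 := by simp [vonMangoldtDiffLog]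
    rw [this, zero_add]
    refine sum_congr rfl fun n hn => ?_
    rw [vonMangoldtDiffLog, if_neg (mem_Ioc.1 hn).1.ne']
    ring
  have e2 : ∑ n ∈ Icc 0 ⌊x⌋₊, (if n.Prime then Real.log n ^ (2 * m + 1) else 0)
      = ∑ n ∈ Ioc 0 ⌊x⌋₊, (if n.Prime then Real.log n ^ (2 * m + 1) else 0) := by
    rw [← add_sum_Ioc_eq_sum_Icc (Nat.zero_le _)]
    simp [Nat.not_prime_zero]
  rw [e1] at a1
  rw [e2, abs_le]
  constructor <;> linarith
end

section
open Complex Set Topology MeasureTheory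

/-- The function `u ↦ u^w / (log u)^j`. -/
noncomputable def cpowDivLogPow (w : ℂ) (j : ℕ) (u : ℝ) : ℂ :=
  exp (w * (Real.log u : ℂ)) / (Real.log u : ℂ) ^ j

lemma norm_cpowDivLogPow (w : ℂ) (j : ℕ) {u : ℝ} (hu : 1 < u) :
    ‖cpowDivLogPow w j u‖ = u ^ w.re / Real.log u ^ j := by
  rw [cpowDivLogPow, norm_div, norm_pow, norm_real, Real.norm_of_nonneg (Real.log_pos hu).le,
    norm_exp, Real.rpow_def_of_pos (by linarith)]
  simp [mul_comm]

lemma hasDerivAt_cpowDivLogPow (w : ℂ) (j : ℕ) {u : ℝ} (hu : 1 < u) :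
    HasDerivAt (cpowDivLogPow w j)
      (w * cpowDivLogPow (w - 1) j u - j * cpowDivLogPow (w - 1) (j + 1) u) u := by
  have hu0 : u ≠ 0 := by linarith
  have hL : (Real.log u : ℂ) ≠ 0 := ofReal_ne_zero.2 (Real.log_pos hu).ne'
  have h1 : HasDerivAt (fun v : ℝ => (Real.log v : ℂ)) ((u⁻¹ : ℝ) : ℂ) u :=
    (Real.hasDerivAt_log hu0).ofReal_comp
  have h2 := ((h1.const_mul w).cexp).div (h1.pow j) (pow_ne_zero j hL)
  have e : exp ((w - 1) * (Real.log u : ℂ)) = exp (w * (Real.log u : ℂ)) * ((u⁻¹ : ℝ) : ℂ) := by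
    rw [sub_mul, one_mul, exp_sub, ← ofReal_exp, Real.exp_log (by linarith), div_eq_mul_inv,
      ofReal_inv]
  refine h2.congr_deriv ?_
  simp only [cpowDivLogPow, e]
  rcases j with _ | j
  · simp; ring
  · simp only [Nat.add_sub_cancel, Pi.pow_apply]
    field_simp
    ring

lemma continuousOn_cpowDivLogPow (w : ℂ) (j : ℕ) : ContinuousOn (cpowDivLogPow w j) (Ioi 1) :=
  fun _ hu => (hasDerivAt_cpowDivLogPow w j hu).continuousAt.continuousWithinAt

/-- The partial sums of the asymptotic expansion of `∫ u^s / log u`. -/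
noncomputable def piPowExpansion (s : ℂ) (M : ℕ) (x : ℝ) : ℂ :=
  ∑ k ∈ Finset.range M, (Nat.factorial k : ℂ) * exp ((s + 1) * (Real.log x : ℂ))
    / ((s + 1) * (Real.log x : ℂ)) ^ (k + 1)

lemma hasDerivAt_piPowExpansion {s : ℂ} (hs : s + 1 ≠ 0) (M : ℕ) {u : ℝ} (hu : 1 < u) :
    HasDerivAt (piPowExpansion s M)
      (cpowDivLogPow s 1 u - M.factorial / (s + 1) ^ M * cpowDivLogPow s (M + 1) u) u := by
  have e : piPowExpansion s M = fun x => ∑ k ∈ Finset.range M,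
      (Nat.factorial k : ℂ) / (s + 1) ^ (k + 1) * cpowDivLogPow (s + 1) (k + 1) x := by
    funext x
    refine Finset.sum_congr rfl fun k _ => ?_
    rw [cpowDivLogPow, mul_pow, div_mul_div_comm]
  rw [e]
  refine (HasDerivAt.fun_sum fun k _ =>
    (hasDerivAt_cpowDivLogPow (s + 1) (k + 1) hu).const_mul _).congr_deriv ?_
  have h := Finset.sum_range_sub' (fun k : ℕ =>
    (Nat.factorial k : ℂ) / (s + 1) ^ k * cpowDivLogPow s (k + 1) u) M
  simp only [Nat.factorial_zero, Nat.cast_one, pow_zero, div_one, one_mul, zero_add] at h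
  rw [← h]
  refine Finset.sum_congr rfl fun k _ => ?_
  rw [add_sub_cancel_right, Nat.factorial_succ]
  push_cast
  field_simp
  ring

lemma hasDerivAt_rpow_div_log_pow (σ : ℝ) (j : ℕ) {u : ℝ} (hu : 1 < u) :
    HasDerivAt (fun v : ℝ => v ^ (σ + 1) / Real.log v ^ j)
      ((σ + 1) * (u ^ σ / Real.log u ^ j) - j * (u ^ σ / Real.log u ^ (j + 1))) u := by
  have hu0 : 0 < u := by linarith
  have hL : Real.log u ≠ 0 := (Real.log_pos hu).ne'
  have h1 := (Real.hasDerivAt_rpow_const (p := σ + 1) (Or.inl hu0.ne')).div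
    ((Real.hasDerivAt_log hu0.ne').pow j) (pow_ne_zero j hL)
  refine h1.congr_deriv ?_
  have e : u ^ (σ + 1) = u ^ σ * u := by rw [Real.rpow_add hu0, Real.rpow_one]
  rw [add_sub_cancel_right, e]
  rcases j with _ | j
  · simp
  · simp only [Nat.add_sub_cancel, Pi.pow_apply]
    field_simp
    ring

lemma continuousOn_rpow_div_log_pow (σ : ℝ) (j : ℕ) :
    ContinuousOn (fun v : ℝ => v ^ σ / Real.log v ^ j) (Ioi 1) := by
  have := fun u (hu : u ∈ Ioi (1 : ℝ)) =>
    (hasDerivAt_rpow_div_log_pow (σ - 1) j hu).continuousAt.continuousWithinAt (s := Ioi 1)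
  simp only [sub_add_cancel] at this
  exact this

lemma integral_rpow_div_log_pow_le {σ : ℝ} (hσ : -1 < σ) (j : ℕ) {b x : ℝ} (hb : 1 < b)
    (hbj : 2 * j / (σ + 1) ≤ Real.log b) (hx : b ≤ x) :
    ∫ u in b..x, u ^ σ / Real.log u ^ j ≤ 2 / (σ + 1) * (x ^ (σ + 1) / Real.log x ^ j) := by
  have hσ1 : 0 < σ + 1 := by linarith
  have hsub : uIcc b x ⊆ Ioi 1 := fun u hu => by
    rw [uIcc_of_le hx] at hu; exact hb.trans_le hu.1
  have hint : ∀ i, IntervalIntegrable (fun u : ℝ => u ^ σ / Real.log u ^ i) volume b x :=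
    fun i => ((continuousOn_rpow_div_log_pow σ i).mono hsub).intervalIntegrable
  have hftc := intervalIntegral.integral_eq_sub_of_hasDerivAt
    (fun u hu => hasDerivAt_rpow_div_log_pow σ j (hsub hu))
    (((hint j).const_mul (σ + 1)).sub ((hint (j + 1)).const_mul (j : ℝ)))
  have hH : 0 ≤ b ^ (σ + 1) / Real.log b ^ j :=
    div_nonneg (Real.rpow_nonneg (by linarith) _) (pow_nonneg (Real.log_pos hb).le _)
  have hle : ∫ u in b..x, (σ + 1) / 2 * (u ^ σ / Real.log u ^ j) ≤
      ∫ u in b..x, ((σ + 1) * (u ^ σ / Real.log u ^ j) - j * (u ^ σ / Real.log u ^ (j + 1))) := by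
    refine intervalIntegral.integral_mono_on hx ((hint j).const_mul _)
      (((hint j).const_mul (σ + 1)).sub ((hint (j + 1)).const_mul (j : ℝ))) fun u hu => ?_
    have hu1 : 1 < u := hb.trans_le hu.1
    have hL : 0 < Real.log u := Real.log_pos hu1
    have hLu : 2 * j / (σ + 1) ≤ Real.log u := hbj.trans (Real.log_le_log (by linarith) hu.1)
    rw [div_le_iff₀ hσ1] at hLu
    have h0 : 0 ≤ u ^ σ / Real.log u ^ (j + 1) :=
      div_nonneg (Real.rpow_nonneg (by linarith) _) (pow_nonneg hL.le _)
    have e : u ^ σ / Real.log u ^ j = Real.log u * (u ^ σ / Real.log u ^ (j + 1)) := by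
      field_simp
      ring
    rw [e]
    nlinarith
  rw [intervalIntegral.integral_const_mul, hftc] at hle
  rw [div_mul_eq_mul_div, le_div_iff₀ hσ1]
  linarith

end

section
open Complex Set Topology MeasureTheory

lemma hasDerivAt_integral_log_pow (k : ℕ) {x : ℝ} (hx : 1 < x) :
    HasDerivAt (fun y : ℝ => ∫ u in (1 : ℝ)..y, Real.log u ^ k) (Real.log x ^ k) x := by
  have hc : ContinuousOn (fun u : ℝ => Real.log u ^ k) (Ioi 0) := fun u hu =>
    ((Real.continuousAt_log (ne_of_gt hu)).pow k).continuousWithinAt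
  refine intervalIntegral.integral_hasDerivAt_right ?_ ?_ ?_
  · refine (hc.mono fun u hu => ?_).intervalIntegrable
    rw [uIcc_of_le hx.le] at hu
    exact zero_lt_one.trans_le hu.1
  · exact hc.stronglyMeasurableAtFilter isOpen_Ioi x (show 0 < x by linarith)
  · exact (Real.continuousAt_log (by linarith)).pow k

lemma cpowDivLogPow_mul_log_pow (s : ℂ) (j k : ℕ) {u : ℝ} (hu : 1 < u) :
    cpowDivLogPow s (j + k) u * (Real.log u : ℂ) ^ k = cpowDivLogPow s j u := by
  have hL : (Real.log u : ℂ) ≠ 0 := ofReal_ne_zero.2 (Real.log_pos hu).ne'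
  rw [cpowDivLogPow, cpowDivLogPow, pow_add]
  field_simp

lemma norm_deriv_cpowDivLogPow_mul_le (s : ℂ) (j m : ℕ) {u C : ℝ} {e : ℂ} (hu : 1 < u)
    (hlog : 1 ≤ Real.log u) (he : ‖e‖ ≤ C * u * Real.log u ^ m) :
    ‖(s * cpowDivLogPow (s - 1) (j + m) u - (j + m : ℕ) * cpowDivLogPow (s - 1) (j + m + 1) u) * e‖
      ≤ (‖s‖ + (j + m : ℕ)) * C * (u ^ s.re / Real.log u ^ j) := by
  have hu0 : 0 < u := by linarith
  set q : ℝ := u ^ (s.re - 1) / Real.log u ^ (j + m) with hq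
  have hq0 : 0 ≤ q := by positivity
  have h1 : ‖cpowDivLogPow (s - 1) (j + m) u‖ = q := by
    rw [norm_cpowDivLogPow _ _ hu, sub_re, one_re]
  have h2 : ‖cpowDivLogPow (s - 1) (j + m + 1) u‖ ≤ q := by
    rw [norm_cpowDivLogPow _ _ hu, sub_re, one_re, hq]
    refine div_le_div_of_nonneg_left (by positivity) (by positivity) ?_
    exact pow_le_pow_right₀ hlog (Nat.le_succ _)
  have h3 : ‖s * cpowDivLogPow (s - 1) (j + m) u
      - (j + m : ℕ) * cpowDivLogPow (s - 1) (j + m + 1) u‖ ≤ (‖s‖ + (j + m : ℕ)) * q := by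
    refine (norm_sub_le _ _).trans ?_
    rw [norm_mul, norm_mul, h1, Complex.norm_natCast, add_mul]
    gcongr
  have hq1 : q * (u * Real.log u ^ m) = u ^ s.re / Real.log u ^ j := by
    rw [hq, Real.rpow_sub_one hu0.ne', pow_add]
    field_simp
  rw [norm_mul]
  calc _ ≤ ((‖s‖ + (j + m : ℕ)) * q) * (C * u * Real.log u ^ m) := by gcongr
    _ = (‖s‖ + (j + m : ℕ)) * C * (q * (u * Real.log u ^ m)) := by ring
    _ = _ := by rw [hq1]

lemma exists_norm_sum_prime_cpow_sub_le {s : ℂ} (hs : -1 < s.re) (M : ℕ) :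
    ∃ (b C : ℝ) (D : ℂ), 1 < b ∧ 0 ≤ C ∧ ∀ x : ℝ, b ≤ x →
      ‖∑ n ∈ Finset.Ioc ⌊b⌋₊ ⌊x⌋₊, (if n.Prime then (n : ℂ) ^ s else 0)
        - piPowExpansion s M x - D‖ ≤ C * (x ^ (s.re + 1) / Real.log x ^ (M + 1)) := by
  obtain ⟨C₀, hC₀, hE⟩ := exists_abs_sum_prime_log_pow_sub_integral_le M
  have hs1 : s + 1 ≠ 0 := fun h => by
    have := congrArg re h
    simp at this
    linarith
  have hσ1 : 0 < s.re + 1 := by linarith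
  set K : ℕ := M + 1 + M with hK
  set b : ℝ := Real.exp (max 2 (2 * (M + 1 : ℕ) / (s.re + 1))) with hb
  have hb2 : Real.exp 2 ≤ b := Real.exp_le_exp.2 (le_max_left _ _)
  have hb1 : 1 < b := by linarith [Real.add_one_le_exp 2]
  have hblog : 2 * (M + 1 : ℕ) / (s.re + 1) ≤ Real.log b := by
    rw [hb, Real.log_exp]; exact le_max_right _ _
  have hblog2 : 2 ≤ Real.log b := by
    rw [hb, Real.log_exp]; exact le_max_left _ _
  set c : ℕ → ℂ := fun n => if n.Prime then (Real.log n : ℂ) ^ K else 0 with hc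
  set A : ℝ → ℂ := fun x => ∑ n ∈ Finset.Icc 0 ⌊x⌋₊, c n with hA
  set J : ℝ → ℂ := fun x => ((∫ u in (1 : ℝ)..x, Real.log u ^ (2 * M) : ℝ) : ℂ) with hJ
  have hAJ : ∀ x, b ≤ x → ‖A x - J x‖ ≤ C₀ * x * Real.log x ^ M := by
    intro x hx
    have h := hE x (hb2.trans hx)
    have e : A x - J x = ((∑ n ∈ Finset.Icc 0 ⌊x⌋₊, (if n.Prime then Real.log n ^ (2 * M + 1) else 0)
        - ∫ u in (1 : ℝ)..x, Real.log u ^ (2 * M) : ℝ) : ℂ) := by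
      rw [ofReal_sub, ofReal_sum]
      simp only [hA, hJ, hc]
      congr 1
      refine Finset.sum_congr rfl fun n _ => ?_
      rw [show K = 2 * M + 1 by omega]
      split_ifs <;> simp
    rw [e, norm_real, Real.norm_eq_abs]
    exact h
  set g : ℝ → ℂ := cpowDivLogPow s K with hg
  set g' : ℝ → ℂ := fun u => s * cpowDivLogPow (s - 1) K u - K * cpowDivLogPow (s - 1) (K + 1) u
    with hg'
  set r : ℝ → ℂ := fun u => M.factorial / (s + 1) ^ M * cpowDivLogPow s (M + 1) u with hr
  have hgd : ∀ u, 1 < u → HasDerivAt g (g' u) u := fun u hu => hasDerivAt_cpowDivLogPow s K hu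
  have hg'c : ContinuousOn g' (Ioi 1) :=
    (continuousOn_const.mul (continuousOn_cpowDivLogPow _ _)).sub
      (continuousOn_const.mul (continuousOn_cpowDivLogPow _ _))
  have hrc : ContinuousOn r (Ioi 1) := continuousOn_const.mul (continuousOn_cpowDivLogPow _ _)
  have hJd : ∀ u, 1 < u → HasDerivAt J ((Real.log u : ℂ) ^ (2 * M)) u := fun u hu => by
    have := (hasDerivAt_integral_log_pow (2 * M) hu).ofReal_comp
    simpa [hJ] using this
  have hJc : ContinuousOn J (Ioi 1) := fun u hu => (hJd u hu).continuousAt.continuousWithinAt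
  have hΦ : ∀ u, 1 < u → HasDerivAt (fun v => g v * J v - piPowExpansion s M v)
      (g' u * J u + r u) u := fun u hu => by
    refine (((hgd u hu).mul (hJd u hu)).sub (hasDerivAt_piPowExpansion hs1 M hu)).congr_deriv ?_
    have := cpowDivLogPow_mul_log_pow s 1 (2 * M) hu
    rw [show 1 + 2 * M = K by omega] at this
    rw [hg, this]
    ring
  set C₁ : ℝ := ‖(M.factorial : ℂ) / (s + 1) ^ M‖ with hC₁
  set C₂ : ℝ := (‖s‖ + (M + 1 + M : ℕ)) * C₀ with hC₂
  refine ⟨b, C₀ + (C₁ + C₂) * (2 / (s.re + 1)),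
    -(g b * A b) + (g b * J b - piPowExpansion s M b),
    hb1, by positivity, fun x hx => ?_⟩
  have hx1 : 1 < x := hb1.trans_le hx
  have hsub : Icc b x ⊆ Ioi 1 := fun u hu => hb1.trans_le hu.1
  have hsub' : uIcc b x ⊆ Ioi 1 := by rw [uIcc_of_le hx]; exact hsub
  have hg'i : IntegrableOn g' (Icc b x) := (hg'c.mono hsub).integrableOn_Icc
  have hderiv : EqOn (deriv g) g' (Icc b x) := fun u hu => (hgd u (hsub hu)).deriv
  have habel := sum_mul_eq_sub_sub_integral_mul c (f := g) (by linarith) hx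
    (fun t ht => (hgd t (hsub ht)).differentiableAt)
    (hg'i.congr_fun hderiv.symm measurableSet_Icc)
  have hsum : ∑ n ∈ Finset.Ioc ⌊b⌋₊ ⌊x⌋₊, (if n.Prime then (n : ℂ) ^ s else 0)
      = ∑ n ∈ Finset.Ioc ⌊b⌋₊ ⌊x⌋₊, g n * c n := by
    refine Finset.sum_congr rfl fun n _ => ?_
    simp only [hc]
    split_ifs with h
    · have hn : (1 : ℝ) < n := by exact_mod_cast h.one_lt
      have := cpowDivLogPow_mul_log_pow s 0 K hn
      rw [zero_add] at this
      rw [hg, this, cpowDivLogPow, pow_zero, div_one, cpow_def_of_ne_zero (by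
        exact_mod_cast h.ne_zero), ← natCast_log, mul_comm]
    · simp
  have hint : ∫ t in Ioc b x, deriv g t * ∑ k ∈ Finset.Icc 0 ⌊t⌋₊, c k
      = ∫ t in b..x, g' t * A t := by
    rw [intervalIntegral.integral_of_le hx]
    exact setIntegral_congr_fun measurableSet_Ioc fun t ht => by
      simp only [hA]
      rw [hderiv (Ioc_subset_Icc_self ht)]
  rw [hint] at habel
  have hiA : IntervalIntegrable (fun t => g' t * A t) volume b x := by
    rw [intervalIntegrable_iff_integrableOn_Icc_of_le hx]
    exact integrableOn_mul_sum_Icc c (by linarith) hg'i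
  have hiJ : IntervalIntegrable (fun t => g' t * J t) volume b x :=
    ((hg'c.mul hJc).mono hsub').intervalIntegrable
  have hir : IntervalIntegrable r volume b x := (hrc.mono hsub').intervalIntegrable
  have hftc := intervalIntegral.integral_eq_sub_of_hasDerivAt
    (fun u hu => hΦ u (hsub' hu)) (hiJ.add hir)
  have hcomb : ∫ t in b..x, (r t - g' t * (A t - J t))
      = (∫ t in b..x, (g' t * J t + r t)) - ∫ t in b..x, g' t * A t := by
    rw [← intervalIntegral.integral_sub (hiJ.add hir) hiA]
    refine intervalIntegral.integral_congr fun t _ => ?_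
    ring
  have hbound : ‖∫ t in b..x, (r t - g' t * (A t - J t))‖
      ≤ ∫ t in b..x, (C₁ + C₂) * (t ^ s.re / Real.log t ^ (M + 1)) := by
    refine intervalIntegral.norm_integral_le_of_norm_le hx ?_ ?_
    · refine Eventually.of_forall fun t ht => ?_
      have ht1 : 1 < t := hb1.trans ht.1
      have htl : 1 ≤ Real.log t := by
        linarith [Real.log_le_log (by linarith) ht.1.le]
      have h1 := norm_deriv_cpowDivLogPow_mul_le s (M + 1) M ht1 htl (hAJ t ht.1.le)
      have h2 : ‖r t‖ = C₁ * (t ^ s.re / Real.log t ^ (M + 1)) := by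
        simp only [hr]
        rw [norm_mul, norm_cpowDivLogPow _ _ ht1]
      refine (norm_sub_le _ _).trans ?_
      rw [h2, add_mul]
      exact add_le_add le_rfl h1
    · exact (continuousOn_const.mul
        ((continuousOn_rpow_div_log_pow _ _).mono hsub')).intervalIntegrable
  rw [intervalIntegral.integral_const_mul] at hbound
  have hI := integral_rpow_div_log_pow_le hs (M + 1) hb1 hblog hx
  have hgx : ‖g x * (A x - J x)‖ ≤ C₀ * (x ^ (s.re + 1) / Real.log x ^ (M + 1)) := by
    have hL : 0 < Real.log x := Real.log_pos hx1
    rw [norm_mul, hg, norm_cpowDivLogPow _ _ hx1]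
    calc _ ≤ x ^ s.re / Real.log x ^ K * (C₀ * x * Real.log x ^ M) := by
          gcongr
          exact hAJ x hx
      _ = _ := by
          rw [hK, pow_add _ (M + 1), Real.rpow_add_one (by linarith)]
          field_simp
  have hfinal : ∑ n ∈ Finset.Ioc ⌊b⌋₊ ⌊x⌋₊, (if n.Prime then (n : ℂ) ^ s else 0)
      - piPowExpansion s M x - (-(g b * A b) + (g b * J b - piPowExpansion s M b))
      = g x * (A x - J x) + ∫ t in b..x, (r t - g' t * (A t - J t)) := by
    rw [hsum, habel, hcomb, hftc]
    simp only [hA]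
    ring
  rw [hfinal]
  refine (norm_add_le _ _).trans ?_
  have hC : 0 ≤ C₁ + C₂ := by positivity
  have := mul_le_mul_of_nonneg_left hI hC
  calc _ ≤ C₀ * (x ^ (s.re + 1) / Real.log x ^ (M + 1))
        + (C₁ + C₂) * (2 / (s.re + 1) * (x ^ (s.re + 1) / Real.log x ^ (M + 1))) :=
        add_le_add hgx (hbound.trans this)
    _ = _ := by ring
end

section
open Topology

lemma exists_norm_piPow_sub_le {s : ℂ} (hs : -1 < s.re) (M : ℕ) :
    ∃ C D : ℝ, ∀ᶠ x : ℝ in atTop, ‖piPow s x - piPowExpansion s M x‖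
      ≤ D + C * (x ^ (s.re + 1) / Real.log x ^ (M + 1)) := by
  obtain ⟨b, C, D, -, -, h⟩ := exists_norm_sum_prime_cpow_sub_le hs M
  refine ⟨C, ‖D + piPow s b‖, ?_⟩
  filter_upwards [eventually_ge_atTop b] with x hx
  have e : ∀ y : ℝ, piPow s y
      = ∑ n ∈ Finset.range (⌊y⌋₊ + 1), (if n.Prime then (n : ℂ) ^ s else 0) := fun y => by
    rw [piPow, Nat.primesBelow, Finset.sum_filter]
  have e2 : piPow s x = piPow s b
      + ∑ n ∈ Finset.Ioc ⌊b⌋₊ ⌊x⌋₊, (if n.Prime then (n : ℂ) ^ s else 0) := by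
    have e1 : Finset.Ioc ⌊b⌋₊ ⌊x⌋₊ = Finset.Ico (⌊b⌋₊ + 1) (⌊x⌋₊ + 1) := by
      ext n
      simp only [Finset.mem_Ioc, Finset.mem_Ico]
      omega
    rw [e1, e, e, ← Finset.sum_range_add_sum_Ico _ (Nat.succ_le_succ (Nat.floor_le_floor hx))]
  have e3 : piPow s x - piPowExpansion s M x = (D + piPow s b)
      + (∑ n ∈ Finset.Ioc ⌊b⌋₊ ⌊x⌋₊, (if n.Prime then (n : ℂ) ^ s else 0)
        - piPowExpansion s M x - D) := by
    rw [e2]; ring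
  rw [e3]
  exact (norm_add_le _ _).trans (add_le_add le_rfl (h x hx))
end

/-- For `s ∈ ℂ` with `Re(s) > −1` and every integer `N ≥ 0`,
`∑_{p ≤ x} p^s − ∑_{k=0}^{N−1} k!·x^{s+1}/((s+1)·log x)^{k+1}
  ∼ N!·x^{s+1}/((s+1)·log x)^{N+1}` as `x → ∞`, where `x^{s+1} = e^{(s+1)·log x}`. -/
theorem piPow_asymptotic_expansion (s : ℂ) (hs : -1 < s.re) (N : ℕ) :
    Tendsto (fun x : ℝ =>
        (piPow s x - ∑ k ∈ Finset.range N,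
            (Nat.factorial k : ℂ) * Complex.exp ((s + 1) * (Real.log x : ℂ))
              / ((s + 1) * (Real.log x : ℂ)) ^ (k + 1))
          / ((Nat.factorial N : ℂ) * Complex.exp ((s + 1) * (Real.log x : ℂ))
              / ((s + 1) * (Real.log x : ℂ)) ^ (N + 1)))
      atTop (nhds 1) := by
  obtain ⟨C, D, hbound⟩ := exists_norm_piPow_sub_le hs (N + 1)
  have hs1 : s + 1 ≠ 0 := fun h => by
    have := congrArg Complex.re h
    simp at this
    linarith
  have hσ1 : 0 < s.re + 1 := by linarith
  set κ : ℝ := ‖s + 1‖ ^ (N + 1) / N.factorial with hκ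
  have hlim : Tendsto (fun x : ℝ => κ * (D * (Real.log x ^ (N + 1) / x ^ (s.re + 1))
      + C * (Real.log x)⁻¹)) atTop (nhds 0) := by
    have h1 : Tendsto (fun x : ℝ => Real.log x ^ (N + 1) / x ^ (s.re + 1)) atTop (nhds 0) := by
      have := (isLittleO_log_rpow_rpow_atTop ((N + 1 : ℕ) : ℝ) hσ1).tendsto_div_nhds_zero
      simpa only [Real.rpow_natCast] using this
    have h2 : Tendsto (fun x : ℝ => (Real.log x)⁻¹) atTop (nhds 0) :=
      tendsto_inv_atTop_zero.comp Real.tendsto_log_atTop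
    simpa using ((h1.const_mul D).add (h2.const_mul C)).const_mul κ
  rw [tendsto_iff_norm_sub_tendsto_zero]
  refine squeeze_zero' (Eventually.of_forall fun x => norm_nonneg _) ?_ hlim
  filter_upwards [hbound, eventually_gt_atTop 1] with x hx hx1
  have hL : 0 < Real.log x := Real.log_pos hx1
  have hLC : (Real.log x : ℂ) ≠ 0 := Complex.ofReal_ne_zero.2 hL.ne'
  have hx0 : 0 < x := by linarith
  have hxp : 0 < x ^ (s.re + 1) := Real.rpow_pos_of_pos hx0 _
  set T : ℂ := (Nat.factorial N : ℂ) * Complex.exp ((s + 1) * (Real.log x : ℂ))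
    / ((s + 1) * (Real.log x : ℂ)) ^ (N + 1) with hT
  have hT0 : T ≠ 0 := by
    refine div_ne_zero (mul_ne_zero ?_ (Complex.exp_ne_zero _)) (pow_ne_zero _ (mul_ne_zero hs1 hLC))
    exact_mod_cast N.factorial_ne_zero
  have hTn : ‖T‖ = x ^ (s.re + 1) / (κ * Real.log x ^ (N + 1)) := by
    have h1 : T = N.factorial / (s + 1) ^ (N + 1) * cpowDivLogPow (s + 1) (N + 1) x := by
      rw [hT, cpowDivLogPow, mul_pow, div_mul_div_comm]
    rw [h1, norm_mul, norm_cpowDivLogPow _ _ hx1, norm_div, norm_pow, Complex.norm_natCast, hκ,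
      Complex.add_re, Complex.one_re]
    have : 0 < ‖s + 1‖ := norm_pos_iff.2 hs1
    field_simp
  rw [piPowExpansion, Finset.sum_range_succ, ← sub_sub] at hx
  rw [div_sub_one hT0, norm_div, hTn]
  have hs1n : 0 < ‖s + 1‖ := norm_pos_iff.2 hs1
  have hκ0 : 0 < κ := by positivity
  rw [div_le_iff₀ (by positivity)]
  refine hx.trans (le_of_eq ?_)
  field_simp
  ring
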